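/- arXiv:1601.01161 — 3 statements merged into one kernel-verified Lean document; each statement's English description precedes it below -/
import Mathlib

section
/- Let f ∈ K⟨⟨e0,e1⟩⟩ satisfy f[w ⧢ e0] = 0 for every word w. Then for all integers d ≥ 1, all s_d,…,s_1 ≥ 1 and all l ≥ 1, one has f[e0^{s_d−1} e1 e0^{s_{d−1}−1} e1 ⋯ e0^{s_1−1} e1 e0^l] = Σ_{l_1+⋯+l_d = l, l_i ≥ 0} (Π_{i=1}^{d} binom(−s_i, l_i)) · f[e0^{s_d+l_d−1} e1 ⋯ e0^{s_1+l_1−1} e1]. -/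
/-! Infrastructure: noncommutative formal power series in two letters `e0, e1`,
their ring structure, exponential, inverse, substitution, shuffle products,
and the various words and submodules of coefficients used in the statements. -/

/-- Words over the alphabet `{e0, e1}`: lists over `Fin 2` (`0` is `e0`, `1` is `e1`),
read from left to right. -/
abbrev Word : Type := List (Fin 2)

/-- The depth of a word: its number of letters `e1`. -/
def depth (w : Word) : ℕ := w.count 1

/-- Noncommutative formal power series in `e0, e1` over `K`, encoded by their
coefficient functions on words. -/
def NCS (K : Type*) : Type _ := Word → K

namespace NCS

variable {K : Type*} [CommRing K]

instance : AddCommGroup (NCS K) := Pi.addCommGroup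
instance : SMul K (NCS K) := ⟨fun c f => fun w => c * f w⟩
instance : One (NCS K) := ⟨fun w => if w = [] then 1 else 0⟩
/-- Multiplication of noncommutative power series (Cauchy product on words). -/
instance : Mul (NCS K) := ⟨fun f g => fun w =>
  ∑ i ∈ Finset.range (w.length + 1), f (w.take i) * g (w.drop i)⟩

lemma mul_apply (f g : NCS K) (w : Word) :
    (f * g) w = ∑ i ∈ Finset.range (w.length + 1), f (w.take i) * g (w.drop i) := rfl

lemma add_apply (f g : NCS K) (w : Word) : (f + g) w = f w + g w := rfl

lemma smul_apply (c : K) (f : NCS K) (w : Word) : (c • f) w = c * f w := rfl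

lemma zero_apply (w : Word) : (0 : NCS K) w = 0 := rfl

lemma one_apply (w : Word) : (1 : NCS K) w = if w = [] then 1 else 0 := rfl

/-- Left shift of the coefficient function by a letter. -/
def shift (a : Fin 2) (f : NCS K) : NCS K := fun w => f (a :: w)

lemma mul_nil (f g : NCS K) : (f * g) [] = f [] * g [] := by
  simp [mul_apply]

lemma cons_mul (f g : NCS K) (a : Fin 2) (w : Word) :
    (f * g) (a :: w) = f [] * g (a :: w) + (shift a f * g) w := by
  show (∑ i ∈ Finset.range (w.length + 1 + 1), f ((a :: w).take i) * g ((a :: w).drop i)) = _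
  rw [Finset.sum_range_succ']
  simp only [List.take_succ_cons, List.drop_succ_cons, List.take_zero, List.drop_zero]
  rw [add_comm]
  rfl

private lemma zero_mul' (f : NCS K) : 0 * f = 0 := by
  funext w; simp [mul_apply, zero_apply]

private lemma mul_zero' (f : NCS K) : f * 0 = 0 := by
  funext w; simp [mul_apply, zero_apply]

private lemma add_mul' (f g h : NCS K) : (f + g) * h = f * h + g * h := by
  funext w
  simp [mul_apply, add_apply, add_mul, Finset.sum_add_distrib]

private lemma mul_add' (f g h : NCS K) : f * (g + h) = f * g + f * h := by
  funext w
  simp [mul_apply, add_apply, mul_add, Finset.sum_add_distrib]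

private lemma smul_mul' (c : K) (f g : NCS K) : (c • f) * g = c • (f * g) := by
  funext w
  simp [mul_apply, smul_apply, Finset.mul_sum, mul_assoc]

private lemma one_mul' (f : NCS K) : 1 * f = f := by
  funext w
  cases w with
  | nil => simp [mul_nil, one_apply]
  | cons a w =>
      have : shift a (1 : NCS K) = 0 := by
        funext v; show (if (a :: v : Word) = [] then (1:K) else 0) = 0; simp
      rw [cons_mul, this, zero_mul', zero_apply, one_apply]
      simp

private lemma mul_one' (f : NCS K) : f * 1 = f := by
  funext w
  induction w generalizing f with
  | nil => simp [mul_nil, one_apply]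
  | cons a w ih =>
      rw [cons_mul, one_apply, ih]
      simp [shift]

private lemma mul_assoc' (f g h : NCS K) : f * g * h = f * (g * h) := by
  funext w
  induction w generalizing f g h with
  | nil =>
      simp only [mul_nil]
      ring
  | cons a w ih =>
      have h1 : shift a (f * g) = f [] • shift a g + shift a f * g := by
        funext v
        show (f * g) (a :: v) = _
        rw [cons_mul]
        rfl
      have e1 : (f * g * h) (a :: w)
          = f [] * g [] * h (a :: w)
            + (f [] * ((shift a g * h) w) + ((shift a f * g) * h) w) := by
        rw [cons_mul, h1, add_mul', smul_mul', mul_nil, add_apply, smul_apply]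
      have e2 : (f * (g * h)) (a :: w)
          = f [] * (g [] * h (a :: w) + (shift a g * h) w)
            + (shift a f * (g * h)) w := by
        rw [cons_mul, cons_mul]
      rw [e1, e2, ih]
      ring

instance instRing : Ring (NCS K) where
  __ := (inferInstance : AddCommGroup (NCS K))
  __ := (inferInstance : Mul (NCS K))
  __ := (inferInstance : One (NCS K))
  left_distrib := mul_add'
  right_distrib := add_mul'
  zero_mul := zero_mul'
  mul_zero := mul_zero'
  mul_assoc := mul_assoc'
  one_mul := one_mul'
  mul_one := mul_one'

/-- The inverse of a noncommutative power series, given by the geometric series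
`Σ_k (1-f)^k`.  For `f` with constant coefficient `1` (the only case used) this is
the genuine two-sided multiplicative inverse of `f`. -/
instance : Inv (NCS K) :=
  ⟨fun f => fun w => ∑ k ∈ Finset.range (w.length + 1), ((1 - f) ^ k) w⟩

/-- The series `e0`. -/
def E0 : NCS K := fun w => if w = [0] then 1 else 0

/-- The series `e1`. -/
def E1 : NCS K := fun w => if w = [1] then 1 else 0

/-- The series `e∞ = -e0 - e1`. -/
def Einf : NCS K := -E0 - E1

/-- The finite set of all words of length at most `n`. -/
def wordsLe (n : ℕ) : Finset Word :=
  (Finset.range (n + 1)).biUnion fun k =>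
    Finset.image (fun t : Fin k → Fin 2 => List.ofFn t) Finset.univ

/-- The product of the letters of `w` after the substitution `e0 ↦ a`, `e1 ↦ b`. -/
def prodWord (a b : NCS K) (w : Word) : NCS K :=
  (w.map fun c => if c = 0 then a else b).prod

/-- Substitution `f(e0,e1) ↦ f(a,b)`: the image of `f` under the continuous algebra
endomorphism determined by `e0 ↦ a`, `e1 ↦ b` (for `a`, `b` with zero constant term). -/
def subst (a b : NCS K) (f : NCS K) : NCS K :=
  fun v => ∑ w ∈ wordsLe v.length, f w * prodWord a b w v

/-- The exponential series `exp a = Σ_k a^k/k!` (for `a` with zero constant term). -/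
def expS {K : Type*} [Field K] (a : NCS K) : NCS K :=
  fun w => ∑ k ∈ Finset.range (w.length + 1), (Nat.factorial k : K)⁻¹ * (a ^ k) w

end NCS

/-- The list of all shuffles of two words. -/
def shuffle : Word → Word → List Word
  | [], v => [v]
  | a :: u, [] => [a :: u]
  | a :: u, b :: v =>
      ((shuffle u (b :: v)).map fun w => a :: w) ++ ((shuffle (a :: u) v).map fun w => b :: w)
termination_by u v => u.length + v.length

namespace NCS

variable {K : Type*} [CommRing K]

/-- `f[u ⧢ v]`: the coefficient function `f` applied linearly to the shuffle `u ⧢ v`. -/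
def shufApply (f : NCS K) (u v : Word) : K := ((shuffle u v).map fun w => f w).sum

/-- `f ∈ Π(K)`: group-like elements, i.e. solutions of the shuffle equations with
constant coefficient `1`. -/
def IsPi (f : NCS K) : Prop :=
  f [] = 1 ∧ ∀ u v : Word, shufApply f u v = f u * f v

/-- `f ∈ Π̃(K)`: elements of `Π(K)` whose weight-one coefficients vanish. -/
def IsPiT (f : NCS K) : Prop := IsPi f ∧ f [0] = 0 ∧ f [1] = 0

end NCS

/-- The block `e0^{k-1} e1`. -/
def blk (k : ℕ) : Word := List.replicate (k - 1) 0 ++ [1]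

/-- The word `e0^{s_d-1} e1 e0^{s_{d-1}-1} e1 ⋯ e0^{s_1-1} e1` (only the values
`s 1, …, s d` matter). -/
def wordW (d : ℕ) (s : ℕ → ℕ) : Word :=
  (List.ofFn fun j : Fin d => blk (s (d - (j : ℕ)))).flatten

/-- The word `e0^{s_d-1} e1 ⋯ e0^{s_1-1} e1 e0^{s_0-1}`. -/
def word1 (d : ℕ) (s : ℕ → ℕ) : Word :=
  wordW d s ++ List.replicate (s 0 - 1) 0

/-- The word `W(a_d; a_{d-1}, …, a_1; a_0) = e0^{a_d} e1 e0^{a_{d-1}} e1 ⋯ e1 e0^{a_1} e1 e0^{a_0}`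
of depth `d`. -/
def wordA (d : ℕ) (a : ℕ → ℕ) : Word :=
  List.replicate (a d) 0 ++
    (List.ofFn fun j : Fin d => (1 : Fin 2) :: List.replicate (a (d - 1 - (j : ℕ))) 0).flatten

/-- `binom (−s, l) = (−1)^l · binom (s+l−1, l)`. -/
def nbinom (s l : ℕ) : ℤ := (-1) ^ l * ((s + l - 1).choose l)

/-- Extension of a tuple `t : Fin d → ℕ` to `ℕ → ℕ` so that index `i ∈ {1, …, d}`
reads `t (i-1)` and all other indices read `0`. -/
def extFin (d : ℕ) (t : Fin d → ℕ) : ℕ → ℕ :=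
  fun i => if h : i - 1 < d ∧ 1 ≤ i then t ⟨i - 1, h.1⟩ else 0

namespace NCS

/-- The filtration `Fil_s(C_μ) = Σ_{s1+s2=s} (1/s1!)·ℤ·(μ/2)^{s2}` of `ℚ ⊆ K`
(`μ ≠ 0` case; for `μ = 0` it reduces to `ℤ ⊆ K`). -/
def Fil {K : Type*} [Field K] (μ : K) (s : ℕ) : Submodule ℤ K :=
  Submodule.span ℤ
    {x : K | ∃ s1 s2 : ℕ, s1 + s2 = s ∧ x = (Nat.factorial s1 : K)⁻¹ * (μ / 2) ^ s2}

variable {K : Type*} [CommRing K]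

/-- `M_D(f)`: the ℤ-submodule of `K` generated by the products `f[w_1]⋯f[w_k]`, `k ≥ 1`,
where each `w_j` is a word of depth between `1` and `D`. -/
def Msub (D : ℕ) (f : NCS K) : Submodule ℤ K :=
  Submodule.span ℤ
    {x : K | ∃ l : List Word, l ≠ [] ∧ (∀ w ∈ l, 1 ≤ depth w ∧ depth w ≤ D) ∧
      x = (l.map fun w => f w).prod}

/-- `M^μ_D(f)`: as `Msub` but with coefficients in the filtration `Fil`. -/
def MsubFil {K : Type*} [Field K] (μ : K) (D : ℕ) (f : NCS K) : Submodule ℤ K :=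
  Submodule.span ℤ
    {x : K | ∃ (l : List Word) (c : K), l ≠ [] ∧
      (∀ w ∈ l, 1 ≤ depth w ∧ depth w ≤ D) ∧
      c ∈ Fil μ ((l.map List.length).sum) ∧
      x = c * (l.map fun w => f w).prod}

/-- The one-dimensional associator equations with `μ = 0`: duality (2-cycle), 3-cycle,
and the special automorphism equation. -/
def OneDim0 (Φ : NCS K) : Prop :=
  Φ * subst E1 E0 Φ = 1 ∧
  subst Einf E0 Φ * subst E1 Einf Φ * Φ = 1 ∧
  E0 + Φ⁻¹ * E1 * Φ + (subst E0 Einf Φ)⁻¹ * Einf * subst E0 Einf Φ = 0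

/-- The one-dimensional associator equations with coupling constant `μ ≠ 0`: duality,
hexagon, and the equation of special automorphisms. -/
def OneDimMu {K : Type*} [Field K] (μ : K) (Φ : NCS K) : Prop :=
  subst E1 E0 Φ = Φ⁻¹ ∧
  expS ((μ / 2) • E0) * subst Einf E0 Φ * expS ((μ / 2) • Einf) *
      subst E1 Einf Φ * expS ((μ / 2) • E1) * Φ = 1 ∧
  Φ⁻¹ * expS ((-μ) • E1) * Φ * expS ((-μ) • E0) =
    expS ((μ / 2) • E0) * (subst E0 Einf Φ)⁻¹ * expS (μ • Einf) *
      subst E0 Einf Φ * expS ((-(μ / 2)) • E0)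

end NCS
section
/-- The value of a coefficient function on the shuffle of `u` with `e0`. -/
def auxSh {K : Type*} [CommRing K] (f : Word → K) (u : Word) : K :=
  ((shuffle u [0]).map f).sum

lemma aux_shuf_nil {K : Type*} [CommRing K] (f : Word → K) : auxSh f [] = f [0] := by
  simp [auxSh, shuffle]

lemma aux_shuf_cons {K : Type*} [CommRing K] (f : Word → K) (a : Fin 2) (u : Word) :
    auxSh f (a :: u) = auxSh (fun w => f (a :: w)) u + f (0 :: a :: u) := by
  simp [auxSh, shuffle, Function.comp_def]

lemma aux_shuf_rep {K : Type*} [CommRing K] (n : ℕ) : ∀ (f : Word → K),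
    auxSh f (List.replicate n 0) = ((n : K) + 1) * f (List.replicate (n + 1) 0) := by
  induction n with
  | zero => intro f; simp [aux_shuf_nil]
  | succ n ih =>
    intro f
    rw [List.replicate_succ, aux_shuf_cons, ih]
    simp only [List.replicate_succ]
    push_cast
    ring

lemma aux_shuf_blk {K : Type*} [CommRing K] (n : ℕ) : ∀ (f : Word → K) (v : Word),
    auxSh f (blk (n + 1) ++ v) = ((n : K) + 1) * f (blk (n + 2) ++ v)
      + auxSh (fun w => f (blk (n + 1) ++ w)) v := by
  induction n with
  | zero => intro f v; simp [blk, aux_shuf_cons, add_comm]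
  | succ n ih =>
    intro f v
    have h : ∀ m (w : Word), blk (m + 2) ++ w = 0 :: (blk (m + 1) ++ w) := by
      intro m w; simp [blk, List.replicate_succ]
    rw [h n v, aux_shuf_cons, ih]
    simp only [h]
    push_cast
    ring

lemma aux_wordW_succ (d : ℕ) (s : ℕ → ℕ) : wordW (d + 1) s = blk (s (d + 1)) ++ wordW d s := by
  simp [wordW, List.ofFn_succ]

lemma aux_wordW_congr (d : ℕ) (s s' : ℕ → ℕ) (h : ∀ i, 1 ≤ i → i ≤ d → s i = s' i) :
    wordW d s = wordW d s' := by
  induction d with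
  | zero => simp [wordW]
  | succ d ih =>
    rw [aux_wordW_succ, aux_wordW_succ, h (d + 1) (by omega) le_rfl,
      ih (fun i h1 h2 => h i h1 (by omega))]

lemma aux_shuf_word {K : Type*} [CommRing K] (l d : ℕ) : ∀ (f : Word → K) (s : ℕ → ℕ),
    (∀ i, 1 ≤ i → i ≤ d → 1 ≤ s i) →
    auxSh f (wordW d s ++ List.replicate l 0)
      = (∑ i : Fin d, (s (i + 1) : K) *
          f (wordW d (Function.update s (i + 1) (s (i + 1) + 1)) ++ List.replicate l 0))
        + ((l : K) + 1) * f (wordW d s ++ List.replicate (l + 1) 0) := by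
  induction d with
  | zero => intro f s _; simp [wordW, aux_shuf_rep]
  | succ d ih =>
    intro f s hs
    obtain ⟨n, hn⟩ : ∃ n, s (d + 1) = n + 1 := ⟨s (d + 1) - 1, by
      have := hs (d + 1) (by omega) le_rfl; omega⟩
    rw [aux_wordW_succ, hn, List.append_assoc, aux_shuf_blk,
      ih _ s (fun i h1 h2 => hs i h1 (by omega)), Fin.sum_univ_castSucc]
    have e1 : wordW (d + 1) (Function.update s (d + 1) (s (d + 1) + 1))
        = blk (n + 2) ++ wordW d s := by
      rw [aux_wordW_succ, Function.update_self, hn]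
      congr 1
      apply aux_wordW_congr
      intro i _ h2
      rw [Function.update_of_ne (by omega)]
    have e2 : ∀ i : Fin d, wordW (d + 1) (Function.update s (i + 1) (s (i + 1) + 1))
        = blk (n + 1) ++ wordW d (Function.update s (i + 1) (s (i + 1) + 1)) := by
      intro i
      rw [aux_wordW_succ, Function.update_of_ne (by have := i.2; omega), hn]
    simp only [Fin.val_castSucc, Fin.val_last, e1, e2, List.append_assoc]
    rw [hn]
    push_cast
    ring

lemma aux_nbinom (s t : ℕ) :
    -(s : ℤ) * nbinom (s + 1) t = ((t : ℤ) + 1) * nbinom s (t + 1) := by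
  have h := Nat.choose_succ_right_eq (s + t) t
  rw [Nat.add_sub_cancel] at h
  have h' : (((s + t).choose (t + 1) : ℕ) : ℤ) * (t + 1) = ((s + t).choose t : ℕ) * s := by
    exact_mod_cast h
  unfold nbinom
  rw [show s + 1 + t - 1 = s + t by omega, show s + (t + 1) - 1 = s + t by omega, pow_succ]
  linear_combination ((-1 : ℤ) ^ t) * h'

lemma aux_step {K : Type*} [CommRing K] (d l : ℕ) (s : ℕ → ℕ) (i : Fin d)
    (F : (ℕ → ℕ) → K) :
    -(s (i + 1) : K) * ∑ t ∈ Finset.Nat.antidiagonalTuple d l,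
        (∏ j : Fin d, (nbinom (Function.update s (i + 1) (s (i + 1) + 1) ((j : ℕ) + 1)) (t j) : K))
          * F (fun j => Function.update s (i + 1) (s (i + 1) + 1) j + extFin d t j)
      = ∑ u ∈ Finset.Nat.antidiagonalTuple d (l + 1),
        (u i : K) * ((∏ j : Fin d, (nbinom (s ((j : ℕ) + 1)) (u j) : K))
          * F (fun j => s j + extFin d u j)) := by
  classical
  rw [Finset.mul_sum]
  have key : ∀ t : Fin d → ℕ, -(s (i + 1) : K) *
      ((∏ j : Fin d, (nbinom (Function.update s (i + 1) (s (i + 1) + 1) ((j : ℕ) + 1)) (t j) : K))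
          * F (fun j => Function.update s (i + 1) (s (i + 1) + 1) j + extFin d t j))
      = (((t + Pi.single i 1 : Fin d → ℕ) i : ℕ) : K) *
        ((∏ j : Fin d, (nbinom (s ((j : ℕ) + 1)) ((t + Pi.single i 1 : Fin d → ℕ) j) : K))
          * F (fun j => s j + extFin d (t + Pi.single i 1) j)) := by
    intro t
    have hF : (fun j => Function.update s (i + 1) (s (i + 1) + 1) j + extFin d t j)
        = (fun j => s j + extFin d (t + Pi.single i 1) j) := by
      funext j
      by_cases hj : j = i + 1
      · subst hj
        have := i.2
        simp [extFin]
        omega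
      · rw [Function.update_of_ne hj]
        congr 1
        unfold extFin
        split_ifs with h
        · have : (⟨j - 1, h.1⟩ : Fin d) ≠ i := by
            intro h'
            apply hj
            rw [← h']
            simp
            omega
          simp [this]
        · rfl
    rw [hF, ← mul_assoc, ← mul_assoc]
    congr 1
    rw [← Finset.mul_prod_erase _ _ (Finset.mem_univ i),
      ← Finset.mul_prod_erase _ _ (Finset.mem_univ i), ← mul_assoc, ← mul_assoc]
    congr 1
    · simp only [Function.update_self, Pi.add_apply, Pi.single_eq_same]
      have := congrArg (Int.cast : ℤ → K) (aux_nbinom (s (i + 1)) (t i))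
      push_cast at this ⊢
      exact this
    · apply Finset.prod_congr rfl
      intro j hj
      have hj : j ≠ i := Finset.ne_of_mem_erase hj
      have hj' : (j : ℕ) + 1 ≠ i + 1 := by
        intro h
        exact hj (Fin.ext (by omega))
      rw [Function.update_of_ne hj']
      simp [hj]
  rw [Finset.sum_congr rfl (fun t _ => key t)]
  refine Finset.sum_bij_ne_zero (fun t _ _ => t + Pi.single i 1) ?_ ?_ ?_ ?_
  · intro t ht _
    rw [Finset.Nat.mem_antidiagonalTuple] at ht ⊢
    simp [Finset.sum_add_distrib, ht]
  · intro t _ _ t' _ _ h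
    exact add_right_cancel h
  · intro u hu hne
    have hi : 1 ≤ u i := by
      rcases Nat.eq_zero_or_pos (u i) with h | h
      · simp [h] at hne
      · exact h
    have hu' : u - Pi.single i 1 + Pi.single i 1 = u := by
      funext j
      by_cases hj : j = i
      · subst hj
        simp
        omega
      · simp [hj]
    refine ⟨u - Pi.single i 1, ?_, ?_, hu'⟩
    · rw [Finset.Nat.mem_antidiagonalTuple] at hu ⊢
      have h2 : ∑ j, (u - Pi.single i 1 + Pi.single i 1 : Fin d → ℕ) j = l + 1 := by
        rw [hu', hu]
      simp only [Pi.add_apply, Finset.sum_add_distrib, Finset.sum_pi_single'] at h2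
      simpa using h2
    · rw [hu']
      exact hne
  · intro t ht _
    rfl

lemma aux_main {K : Type*} [Field K] [CharZero K] (f : Word → K)
    (hf : ∀ w : Word, auxSh f w = 0) (d l : ℕ) : ∀ s : ℕ → ℕ,
    (∀ i, 1 ≤ i → i ≤ d → 1 ≤ s i) →
    f (wordW d s ++ List.replicate l 0)
      = ∑ t ∈ Finset.Nat.antidiagonalTuple d l,
          (∏ i : Fin d, (nbinom (s ((i : ℕ) + 1)) (t i) : K))
            * f (wordW d fun j => s j + extFin d t j) := by
  induction l with
  | zero =>
    intro s _
    have h : extFin d 0 = fun _ => 0 := by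
      funext j
      simp [extFin]
    simp [Finset.Nat.antidiagonalTuple_zero_right, nbinom, h]
  | succ l ih =>
    intro s hs
    have h0 := aux_shuf_word l d f s hs
    rw [hf] at h0
    have hl : ((l : K) + 1) ≠ 0 := Nat.cast_add_one_ne_zero l
    apply mul_left_cancel₀ hl
    have h1 : ((l : K) + 1) * f (wordW d s ++ List.replicate (l + 1) 0)
        = ∑ i : Fin d, -(s (i + 1) : K) *
          f (wordW d (Function.update s (i + 1) (s (i + 1) + 1)) ++ List.replicate l 0) := by
      simp only [neg_mul, Finset.sum_neg_distrib]
      linear_combination -h0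
    rw [h1]
    have h2 : ∀ i : Fin d, -(s (i + 1) : K) *
          f (wordW d (Function.update s (i + 1) (s (i + 1) + 1)) ++ List.replicate l 0)
        = ∑ u ∈ Finset.Nat.antidiagonalTuple d (l + 1),
        (u i : K) * ((∏ j : Fin d, (nbinom (s ((j : ℕ) + 1)) (u j) : K))
          * f (wordW d fun j => s j + extFin d u j)) := by
      intro i
      rw [ih]
      · exact aux_step d l s i (fun r => f (wordW d r))
      · intro j hj1 hj2
        have := hs j hj1 hj2
        by_cases hj : j = i + 1
        · subst hj
          simp
        · rw [Function.update_of_ne hj]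
          exact this
    rw [Finset.sum_congr rfl (fun i _ => h2 i), Finset.sum_comm, Finset.mul_sum]
    apply Finset.sum_congr rfl
    intro u hu
    rw [← Finset.sum_mul]
    congr 1
    rw [Finset.Nat.mem_antidiagonalTuple] at hu
    exact_mod_cast hu

end

open NCS in
/-- coefficients of a series killed by `⧢ e0` on words with a trailing
power of `e0`, in terms of coefficients on words ending with `e1`. -/
theorem stmt_0 {K : Type*} [Field K] [CharZero K] (f : NCS K)
    (hf : ∀ w : Word, shufApply f w [0] = 0) :
    ∀ d : ℕ, 1 ≤ d → ∀ s : ℕ → ℕ, (∀ i, 1 ≤ i → i ≤ d → 1 ≤ s i) →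
    ∀ l : ℕ, 1 ≤ l →
    f (wordW d s ++ List.replicate l 0)
      = ∑ t ∈ Finset.Nat.antidiagonalTuple d l,
          (∏ i : Fin d, (nbinom (s ((i : ℕ) + 1)) (t i) : K))
            * f (wordW d fun j => s j + extFin d t j) := by
  intro d _ s hs l _
  exact aux_main f hf d l s hs
end

section
/- Let Φ ∈ Π̃(K) satisfy the one-dimensional associator equations with μ = 0, and set Φ∞ := Φ(e0,e∞). Then for every integer d ≥ 1 one has the equality of ℤ-submodules of K: M_{d−1}(Φ) = M_d(Φ∞). In particular, for d = 1 one gets M_1(Φ∞) = 0, i.e. all coefficients of Φ∞ on words of depth 1 vanish. -/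
namespace NCS

section aux
variable {K : Type*} [CommRing K]

lemma aux_sub_apply (f g : NCS K) (w : Word) : (f - g) w = f w - g w := rfl
lemma aux_neg_apply (f : NCS K) (w : Word) : (-f) w = -f w := rfl

/-- The series of a single letter. -/
def auxL (c : Fin 2) : NCS K := fun w => if w = [c] then 1 else 0

lemma auxE0 : (E0 : NCS K) = auxL 0 := rfl
lemma auxE1 : (E1 : NCS K) = auxL 1 := rfl

lemma aux_shift_L (c a : Fin 2) : shift a (auxL c : NCS K) = if a = c then 1 else 0 := by
  funext w
  by_cases h : a = c
  · simp [shift, auxL, h, one_apply]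
  · simp [shift, auxL, h, zero_apply]

lemma auxL_mul_nil (c : Fin 2) (f : NCS K) : (auxL c * f : NCS K) [] = 0 := by
  simp [mul_nil, auxL]

lemma aux_mulL_nil (c : Fin 2) (f : NCS K) : (f * auxL c : NCS K) [] = 0 := by
  simp [mul_nil, auxL]

lemma auxL_mul_cons (c a : Fin 2) (f : NCS K) (w : Word) :
    (auxL c * f : NCS K) (a :: w) = if a = c then f w else 0 := by
  rw [cons_mul, aux_shift_L]
  by_cases h : a = c
  · simp [h, auxL]
  · simp [h, auxL, zero_apply]

lemma aux_mulL_append (c b : Fin 2) (f : NCS K) (w : Word) :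
    (f * auxL c : NCS K) (w ++ [b]) = if b = c then f w else 0 := by
  induction w generalizing f with
  | nil =>
      rw [List.nil_append, cons_mul, aux_mulL_nil]
      simp [auxL]
  | cons a w ih =>
      rw [List.cons_append, cons_mul, ih]
      simp [auxL, shift]

/-- Vanishing in depth `< r`, values in `N` in depth `≤ D`. -/
def auxGood (N : Submodule ℤ K) (r D : ℕ) (a : NCS K) : Prop :=
  ∀ w : Word, (depth w < r → a w = 0) ∧ (depth w ≤ D → a w ∈ N)

variable {N : Submodule ℤ K}

lemma auxGood.mono {r r' D D' : ℕ} {a : NCS K} (h : auxGood N r D a) (hr : r' ≤ r)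
    (hD : D' ≤ D) : auxGood N r' D' a :=
  fun w => ⟨fun h1 => (h w).1 (by omega), fun h1 => (h w).2 (by omega)⟩

lemma auxGood.add {r D : ℕ} {a b : NCS K} (ha : auxGood N r D a) (hb : auxGood N r D b) :
    auxGood N r D (a + b) := fun w =>
  ⟨fun h => by rw [add_apply, (ha w).1 h, (hb w).1 h, add_zero],
   fun h => by rw [add_apply]; exact N.add_mem ((ha w).2 h) ((hb w).2 h)⟩

lemma auxGood.neg {r D : ℕ} {a : NCS K} (ha : auxGood N r D a) : auxGood N r D (-a) := fun w =>
  ⟨fun h => by rw [aux_neg_apply, (ha w).1 h, neg_zero],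
   fun h => by rw [aux_neg_apply]; exact N.neg_mem ((ha w).2 h)⟩

lemma auxGood.sub {r D : ℕ} {a b : NCS K} (ha : auxGood N r D a) (hb : auxGood N r D b) :
    auxGood N r D (a - b) := by
  rw [sub_eq_add_neg]; exact ha.add hb.neg

lemma aux_depth_take_drop (w : Word) (i : ℕ) : depth (w.take i) + depth (w.drop i) = depth w := by
  unfold depth
  rw [← List.count_append, List.take_append_drop]

lemma auxGood.mul (hN : ∀ x ∈ N, ∀ y ∈ N, x * y ∈ N) {r s p q : ℕ} {a b : NCS K}
    (ha : auxGood N r p a) (hb : auxGood N s q b) {D : ℕ} (h1 : D ≤ p + s) (h2 : D ≤ q + r) :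
    auxGood N (r + s) D (a * b) := by
  intro w
  constructor
  · intro h
    rw [mul_apply]
    refine Finset.sum_eq_zero fun i _ => ?_
    have hd := aux_depth_take_drop w i
    by_cases hr : depth (w.take i) < r
    · rw [(ha _).1 hr, zero_mul]
    · rw [(hb _).1 (by omega), mul_zero]
  · intro h
    rw [mul_apply]
    refine N.sum_mem fun i _ => ?_
    have hd := aux_depth_take_drop w i
    by_cases hr : depth (w.take i) < r
    · rw [(ha _).1 hr, zero_mul]; exact N.zero_mem
    by_cases hs : depth (w.drop i) < s
    · rw [(hb _).1 hs, mul_zero]; exact N.zero_mem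
    exact hN _ ((ha _).2 (by omega)) _ ((hb _).2 (by omega))

lemma auxGood.E1_mul {r D : ℕ} {a : NCS K} (ha : auxGood N r D a) :
    auxGood N (r + 1) (D + 1) (E1 * a) := by
  intro w
  rw [auxE1]
  cases w with
  | nil => simp [auxL_mul_nil]
  | cons c w =>
      rw [auxL_mul_cons]
      by_cases hc : c = 1
      · subst hc
        have : depth (1 :: w) = depth w + 1 := by simp [depth]
        simp only [if_true, this]
        exact ⟨fun h => (ha w).1 (by omega), fun h => (ha w).2 (by omega)⟩
      · simp [hc]

lemma auxGood.mul_E1 {r D : ℕ} {a : NCS K} (ha : auxGood N r D a) :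
    auxGood N (r + 1) (D + 1) (a * E1) := by
  intro w
  rw [auxE1]
  induction w using List.reverseRecOn with
  | nil => simp [aux_mulL_nil]
  | append_singleton w c _ =>
      rw [aux_mulL_append]
      by_cases hc : c = 1
      · subst hc
        have : depth (w ++ [1]) = depth w + 1 := by simp [depth]
        simp only [if_true, this]
        exact ⟨fun h => (ha w).1 (by omega), fun h => (ha w).2 (by omega)⟩
      · simp [hc]

lemma auxGood.E0_mul {r D : ℕ} {a : NCS K} (ha : auxGood N r D a) :
    auxGood N r D (E0 * a) := by
  intro w
  rw [auxE0]
  cases w with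
  | nil => simp [auxL_mul_nil]
  | cons c w =>
      rw [auxL_mul_cons]
      by_cases hc : c = 0
      · subst hc
        have : depth (0 :: w) = depth w := by simp [depth]
        simp only [if_true, this]
        exact ha w
      · simp [hc]

lemma auxGood.mul_E0 {r D : ℕ} {a : NCS K} (ha : auxGood N r D a) :
    auxGood N r D (a * E0) := by
  intro w
  rw [auxE0]
  induction w using List.reverseRecOn with
  | nil => simp [aux_mulL_nil]
  | append_singleton w c _ =>
      rw [aux_mulL_append]
      by_cases hc : c = 0
      · subst hc
        have : depth (w ++ [0]) = depth w := by simp [depth]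
        simp only [if_true, this]
        exact ha w
      · simp [hc]

/-- Recovering a series from its commutator with a letter. -/
lemma aux_comm (c : Fin 2) (f : NCS K) (hf : ∀ n, f (List.replicate n c) = 0) (m : ℕ)
    (hR : ∀ v, depth v ≤ m → (auxL c * f - f * auxL c : NCS K) (c :: v) ∈ N) :
    ∀ v, depth v ≤ m → f v ∈ N := by
  have key : ∀ k (u : Word) (b : Fin 2), b ≠ c →
      depth (u ++ [b] ++ List.replicate k c) ≤ m → f (u ++ [b] ++ List.replicate k c) ∈ N := by
    intro k
    induction k with
    | zero =>
        intro u b hb hd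
        have := hR _ hd
        simp only [List.replicate_zero, List.append_nil] at this ⊢
        rw [aux_sub_apply, auxL_mul_cons, ← List.cons_append, aux_mulL_append] at this
        simpa [hb] using this
    | succ k ih =>
        intro u b hb hd
        have h1 := hR _ hd
        have h2 := ih (c :: u) b hb (by
          refine le_trans (le_of_eq ?_) hd
          simp only [depth, List.count_append, List.count_cons, List.replicate_succ]
          ring)
        rw [List.replicate_succ', ← List.append_assoc] at h1 ⊢
        rw [aux_sub_apply, auxL_mul_cons, ← List.cons_append, aux_mulL_append] at h1
        simp only [if_true] at h1
        have := N.add_mem h1 h2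
        simpa using this
  intro v hv
  have dec : (∃ n, v = List.replicate n c) ∨
      ∃ u b k, b ≠ c ∧ v = u ++ [b] ++ List.replicate k c := by
    clear hv
    induction v using List.reverseRecOn with
    | nil => exact Or.inl ⟨0, rfl⟩
    | append_singleton w b ih =>
        by_cases hb : b = c
        · subst hb
          rcases ih with ⟨n, rfl⟩ | ⟨u, b', k, hb', rfl⟩
          · exact Or.inl ⟨n + 1, by rw [List.replicate_succ']⟩
          · exact Or.inr ⟨u, b', k + 1, hb', by rw [List.replicate_succ', ← List.append_assoc]⟩
        · exact Or.inr ⟨w, b, 0, hb, by simp⟩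
  rcases dec with ⟨n, rfl⟩ | ⟨u, b, k, hb, rfl⟩
  · rw [hf]; exact N.zero_mem
  · exact key k u b hb hv

lemma aux_depth_zero {w : Word} (h : depth w = 0) : w = List.replicate w.length 0 := by
  rw [List.eq_replicate_iff]
  refine ⟨rfl, fun b hb => ?_⟩
  unfold depth at h
  rw [List.count_eq_zero] at h
  have : b ≠ 1 := fun hb1 => h (hb1 ▸ hb)
  omega

lemma aux_depth_rep (n : ℕ) : depth (List.replicate n 0) = 0 := by
  simp [depth, List.count_replicate]

lemma auxGood_zero {f : NCS K} (hf : ∀ n, f (List.replicate n 0) = 0) : auxGood N 1 0 f := by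
  intro w
  have : depth w = 0 → f w = 0 := fun h => by rw [aux_depth_zero h]; exact hf _
  refine ⟨fun h => this (by omega), fun h => ?_⟩
  rw [this (by omega)]; exact N.zero_mem

lemma auxGood_of_comm0 {f : NCS K} (hf : ∀ n, f (List.replicate n 0) = 0) {m : ℕ}
    (hR : auxGood N 0 m (E0 * f - f * E0)) : auxGood N 1 m f := by
  intro w
  refine ⟨((auxGood_zero (N := N) hf) w).1, ?_⟩
  refine aux_comm 0 f hf m (fun v hv => (hR (0 :: v)).2 ?_) w
  simpa [depth] using hv

lemma auxGood_of_comm1 {f : NCS K} (hf : ∀ n, f (List.replicate n 0) = 0)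
    (hf1 : ∀ n, f (List.replicate n 1) = 0) {m : ℕ}
    (hR : auxGood N 0 (m + 1) (E1 * f - f * E1)) : auxGood N 1 m f := by
  intro w
  refine ⟨((auxGood_zero (N := N) hf) w).1, ?_⟩
  refine aux_comm 1 f hf1 m (fun v hv => (hR (1 :: v)).2 ?_) w
  simpa [depth] using hv

/-! inverse -/

lemma aux_pow_zero {g : NCS K} (hg : g [] = 0) (k : ℕ) (w : Word) (h : w.length < k) :
    (g ^ k) w = 0 := by
  induction k generalizing w with
  | zero => omega
  | succ k ih =>
      rw [pow_succ, mul_apply]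
      refine Finset.sum_eq_zero fun i hi => ?_
      by_cases h2 : (w.take i).length < k
      · rw [ih _ h2, zero_mul]
      · have : w.drop i = [] := by
          rw [List.drop_eq_nil_iff]; simp at h2; omega
        rw [this, hg, mul_zero]

lemma aux_sum_apply {ι : Type*} (s : Finset ι) (F : ι → NCS K) (w : Word) :
    (∑ i ∈ s, F i) w = ∑ i ∈ s, F i w :=
  map_sum (⟨⟨fun f : NCS K => f w, rfl⟩, fun _ _ => rfl⟩ : NCS K →+ K) F s

lemma aux_inv_apply {f : NCS K} (hf : f [] = 1) (w : Word) (n : ℕ) (h : w.length < n) :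
    f⁻¹ w = (∑ k ∈ Finset.range n, (1 - f) ^ k) w := by
  rw [aux_sum_apply]
  show ∑ k ∈ Finset.range (w.length + 1), ((1 - f) ^ k) w = _
  refine Finset.sum_subset (fun x hx => ?_) (fun x _ hx => ?_)
  · simp at hx ⊢; omega
  · refine aux_pow_zero ?_ _ _ ?_
    · rw [aux_sub_apply, hf, one_apply]; simp
    · simp at hx; omega

lemma aux_g_nil {f : NCS K} (hf : f [] = 1) : (1 - f) [] = 0 := by
  rw [aux_sub_apply, hf, one_apply]; simp

lemma aux_inv_mul {f : NCS K} (hf : f [] = 1) : f⁻¹ * f = 1 := by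
  funext w
  have h1 : (f⁻¹ * f) w = ((∑ k ∈ Finset.range (w.length + 1), (1 - f) ^ k) * f) w := by
    rw [mul_apply, mul_apply]
    refine Finset.sum_congr rfl fun i hi => ?_
    rw [aux_inv_apply hf (w.take i) (w.length + 1) (by simp)]
  have h2 := geom_sum_mul_neg (1 - f) (w.length + 1)
  rw [sub_sub_cancel] at h2
  rw [h1, h2, aux_sub_apply, aux_pow_zero (aux_g_nil hf) _ _ (by omega), sub_zero]

lemma aux_mul_inv {f : NCS K} (hf : f [] = 1) : f * f⁻¹ = 1 := by
  funext w
  have h1 : (f * f⁻¹) w = (f * (∑ k ∈ Finset.range (w.length + 1), (1 - f) ^ k)) w := by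
    rw [mul_apply, mul_apply]
    refine Finset.sum_congr rfl fun i hi => ?_
    rw [aux_inv_apply hf (w.drop i) (w.length + 1) (by simp)]
  have h2 := mul_neg_geom_sum (1 - f) (w.length + 1)
  rw [sub_sub_cancel] at h2
  rw [h1, h2, aux_sub_apply, aux_pow_zero (aux_g_nil hf) _ _ (by omega), sub_zero]

lemma auxGood_inv (hN : ∀ x ∈ N, ∀ y ∈ N, x * y ∈ N) {f : NCS K} (hf : f [] = 1) {D : ℕ}
    (h : auxGood N 1 D (f - 1)) : auxGood N 1 D (f⁻¹ - 1) := by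
  have hp : ∀ k, auxGood N 1 D ((1 - f) ^ (k + 1)) := by
    intro k
    induction k with
    | zero => rw [zero_add, pow_one, ← neg_sub]; exact h.neg
    | succ k ih =>
        rw [pow_succ]
        have h' : auxGood N 1 D (1 - f) := by rw [← neg_sub]; exact h.neg
        exact (auxGood.mul hN ih h' (D := D) (by omega) (by omega)).mono (by omega) le_rfl
  have e : ∀ w, (f⁻¹ - 1) w = ∑ k ∈ Finset.range w.length, ((1 - f) ^ (k + 1)) w := by
    intro w
    rw [aux_sub_apply]
    show (∑ k ∈ Finset.range (w.length + 1), ((1 - f) ^ k) w) - _ = _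
    rw [Finset.sum_range_succ', pow_zero, add_sub_cancel_right]
  intro w
  rw [e]
  exact ⟨fun h => Finset.sum_eq_zero fun k _ => (hp k w).1 h,
    fun h => N.sum_mem fun k _ => (hp k w).2 h⟩

/-! depth zero part of `Φ∞` -/

/-- Signed sum over all words of length `n`. -/
def auxG (f : NCS K) (n : ℕ) : K := ∑ t : Fin n → Fin 2, f (List.ofFn t)

lemma auxG_succ (f : NCS K) (n : ℕ) :
    auxG f (n + 1) = auxG (shift 0 f) n + auxG (shift 1 f) n := by
  unfold auxG
  rw [← (Fin.consEquiv (fun _ : Fin (n + 1) => Fin 2)).sum_comp, Fintype.sum_prod_type]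
  simp [Fin.sum_univ_two, Fin.consEquiv, shift, List.ofFn_succ]

/-- Sum over all words of length `n` and depth `j`. -/
def auxT : ℕ → ℕ → NCS K → K
  | 0, 0, f => f []
  | 0, _ + 1, _ => 0
  | n + 1, 0, f => auxT n 0 (shift 0 f)
  | n + 1, j + 1, f => auxT n (j + 1) (shift 0 f) + auxT n j (shift 1 f)

lemma auxT_gt (n j : ℕ) (h : n < j) (f : NCS K) : auxT n j f = 0 := by
  induction n generalizing j f with
  | zero => cases j with
    | zero => omega
    | succ j => rfl
  | succ n ih => cases j with
    | zero => omega
    | succ j => rw [auxT, ih _ (by omega), ih _ (by omega), add_zero]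

lemma aux_shuf_cons (f : NCS K) (a b : Fin 2) (u v : Word) :
    shufApply f (a :: u) (b :: v)
      = shufApply (shift a f) u (b :: v) + shufApply (shift b f) (a :: u) v := by
  simp only [shufApply]
  rw [shuffle]
  simp [shift, Function.comp_def]

lemma aux_shuf_nil_left (f : NCS K) (v : Word) : shufApply f [] v = f v := by
  simp [shufApply, shuffle]

lemma aux_shuf_nil_right (f : NCS K) (u : Word) : shufApply f u [] = f u := by
  cases u <;> simp [shufApply, shuffle]

lemma auxT_shuf (a b : ℕ) (f : NCS K) :
    auxT (a + b) b f = shufApply f (List.replicate a 0) (List.replicate b 1) := by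
  induction hn : a + b generalizing a b f with
  | zero =>
      obtain rfl : a = 0 := by omega
      obtain rfl : b = 0 := by omega
      simp [auxT, aux_shuf_nil_left]
  | succ n ih =>
      cases b with
      | zero =>
          obtain rfl : a = n + 1 := by omega
          rw [auxT, ih n 0 _ (by omega)]
          simp [aux_shuf_nil_right, List.replicate_succ, shift]
      | succ b =>
          cases a with
          | zero =>
              obtain rfl : b = n := by omega
              rw [auxT, auxT_gt _ _ (by omega), ih 0 b _ (by omega)]
              simp [aux_shuf_nil_left, List.replicate_succ, shift]
          | succ a =>
              rw [auxT, ih a (b + 1) _ (by omega), ih (a + 1) b _ (by omega)]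
              rw [List.replicate_succ (n := a), List.replicate_succ (n := b), aux_shuf_cons]

lemma auxT_smul (n j : ℕ) (c : K) (f : NCS K) : auxT n j (c • f) = c * auxT n j f := by
  induction n generalizing j f with
  | zero => cases j <;> simp [auxT, smul_apply]
  | succ n ih =>
      have : ∀ a, shift a (c • f) = c • shift a f := fun a => rfl
      cases j with
      | zero => rw [auxT, auxT, this, ih]
      | succ j => rw [auxT, auxT, this, this, ih, ih, mul_add]

lemma auxG_T (n : ℕ) (f : NCS K) :
    auxG f n = ∑ j ∈ Finset.range (n + 1), auxT n j f := by
  induction n generalizing f with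
  | zero => simp [auxG, auxT]
  | succ n ih =>
      rw [auxG_succ, ih, ih, Finset.sum_range_succ' _ (n + 1)]
      simp only [auxT]
      rw [Finset.sum_add_distrib]
      rw [Finset.sum_range_succ' (fun j => auxT n j (shift 0 f)) n]
      rw [Finset.sum_range_succ (fun j => auxT n (j + 1) (shift 0 f)) n]
      rw [auxT_gt n (n + 1) (by omega)]
      ring

/-- Twisting by the sign of the depth. -/
def auxS (f : NCS K) : NCS K := fun w => (-1) ^ depth w * f w

lemma auxT_S (n j : ℕ) (f : NCS K) : auxT n j (auxS f) = (-1) ^ j * auxT n j f := by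
  induction n generalizing j f with
  | zero => cases j <;> simp [auxT, auxS, depth]
  | succ n ih =>
      have h0 : shift 0 (auxS f) = auxS (shift 0 f) := by
        funext w; simp [shift, auxS, depth]
      have h1 : shift 1 (auxS f) = (-1 : K) • auxS (shift 1 f) := by
        funext w; simp [shift, auxS, depth, smul_apply, pow_succ]
      cases j with
      | zero => rw [auxT, auxT, h0, ih]
      | succ j => rw [auxT, auxT, h0, h1, auxT_smul, ih, ih]; ring

lemma aux_prodWord (w : Word) (m : ℕ) :
    prodWord (E0 : NCS K) Einf w (List.replicate m 0)
      = if w.length = m then (-1) ^ depth w else 0 := by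
  induction w generalizing m with
  | nil =>
      simp only [prodWord, List.map_nil, List.prod_nil, one_apply]
      cases m <;> simp [depth, List.replicate_succ]
  | cons a w ih =>
      have h : prodWord (E0 : NCS K) Einf (a :: w)
          = (if a = 0 then E0 else Einf) * prodWord E0 Einf w := by simp [prodWord]
      have h0 : ∀ (f : NCS K) (m : ℕ), (E0 * f : NCS K) (List.replicate m 0)
          = if m = 0 then 0 else f (List.replicate (m - 1) 0) := by
        intro f m
        rw [auxE0]
        cases m with
        | zero => simp [auxL_mul_nil]
        | succ m => simp [List.replicate_succ, auxL_mul_cons]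
      have h1 : ∀ (f : NCS K) (m : ℕ), (E1 * f : NCS K) (List.replicate m 0) = 0 := by
        intro f m
        rw [auxE1]
        cases m with
        | zero => simp [auxL_mul_nil]
        | succ m => simp [List.replicate_succ, auxL_mul_cons]
      rw [h]
      by_cases ha : a = 0
      · subst ha
        rw [if_pos rfl, h0, ih]
        cases m <;> simp [depth]
      · have ha1 : a = 1 := by omega
        subst ha1
        rw [if_neg (by decide), show (Einf : NCS K) * prodWord E0 Einf w
          = (-E0 - E1) * prodWord E0 Einf w from rfl, sub_mul, neg_mul, aux_sub_apply, aux_neg_apply, h0, h1, ih]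
        cases m with
        | zero => simp
        | succ m =>
            by_cases hm : w.length = m
            · simp [depth, hm, pow_succ]
            · simp [hm]

lemma aux_subst_rep (f : NCS K) (m : ℕ) :
    subst E0 Einf f (List.replicate m 0) = auxG (auxS f) m := by
  show ∑ w ∈ wordsLe (List.replicate m (0 : Fin 2)).length, _ = _
  rw [List.length_replicate, auxG]
  rw [← Finset.sum_image (s := Finset.univ) (f := fun w => auxS f w)
    (g := fun t : Fin m → Fin 2 => List.ofFn t)
    (fun x _ y _ h => List.ofFn_injective h)]
  have hsub : Finset.image (fun t : Fin m → Fin 2 => List.ofFn t) Finset.univ ⊆ wordsLe m := by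
    intro w hw
    exact Finset.mem_biUnion.2 ⟨m, by simp, hw⟩
  rw [← Finset.sum_subset hsub]
  · refine Finset.sum_congr rfl fun w hw => ?_
    obtain ⟨t, -, rfl⟩ := Finset.mem_image.1 hw
    rw [aux_prodWord, if_pos (by simp), auxS, mul_comm]
  · intro w _ hw
    rw [aux_prodWord, if_neg, mul_zero]
    rintro rfl
    exact hw (Finset.mem_image.2 ⟨w.get, Finset.mem_univ _, List.ofFn_get w⟩)

lemma aux_shuf_rep (f : NCS K) (c : Fin 2) (n : ℕ) :
    shufApply f [c] (List.replicate n c) = (n + 1) * f (List.replicate (n + 1) c) := by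
  induction n generalizing f with
  | zero => simp [aux_shuf_nil_right]
  | succ n ih =>
      rw [List.replicate_succ, aux_shuf_cons, aux_shuf_nil_left, ih]
      simp only [shift, List.replicate_succ]
      push_cast
      ring

/-- `M_D` is closed under products. -/
lemma aux_Msub_mul (D : ℕ) (f : NCS K) :
    ∀ x ∈ Msub D f, ∀ y ∈ Msub D f, x * y ∈ Msub D f := by
  intro x hx y hy
  unfold Msub at *
  induction hx using Submodule.span_induction with
  | zero => rw [zero_mul]; exact Submodule.zero_mem _
  | add a b _ _ ha hb => rw [add_mul]; exact Submodule.add_mem _ ha hb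
  | smul c a _ ha => rw [smul_mul_assoc]; exact Submodule.smul_mem _ _ ha
  | mem a ha =>
      induction hy using Submodule.span_induction with
      | zero => rw [mul_zero]; exact Submodule.zero_mem _
      | add b c _ _ hb hc => rw [mul_add]; exact Submodule.add_mem _ hb hc
      | smul c b _ hb => rw [mul_smul_comm]; exact Submodule.smul_mem _ _ hb
      | mem b hb =>
          obtain ⟨l, hl, hl', rfl⟩ := ha
          obtain ⟨l2, hl2, hl2', rfl⟩ := hb
          refine Submodule.subset_span ⟨l ++ l2, by simp [hl], ?_, by simp⟩
          intro w hw
          rcases List.mem_append.1 hw with h | h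
          · exact hl' w h
          · exact hl2' w h

lemma aux_Msub_le (hN : ∀ x ∈ N, ∀ y ∈ N, x * y ∈ N) {D : ℕ} {f : NCS K}
    (h : ∀ w, 1 ≤ depth w → depth w ≤ D → f w ∈ N) : Msub D f ≤ N := by
  refine Submodule.span_le.2 ?_
  rintro x ⟨l, hl, hl', rfl⟩
  induction l with
  | nil => exact absurd rfl hl
  | cons a l ih =>
      have ha : f a ∈ N := h a (hl' a (by simp)).1 (hl' a (by simp)).2
      by_cases hl0 : l = []
      · subst hl0; simpa using ha
      · rw [List.map_cons, List.prod_cons]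
        exact hN _ ha _ (ih hl0 fun w hw => hl' w (by simp [hw]))

lemma aux_mem_Msub {D : ℕ} {f : NCS K} (w : Word) (h1 : 1 ≤ depth w) (h2 : depth w ≤ D) :
    f w ∈ Msub D f :=
  Submodule.subset_span ⟨[w], by simp, by simpa using ⟨h1, h2⟩, by simp⟩

lemma aux_sub_one {f : NCS K} {w : Word} (h : 1 ≤ depth w) : (f - 1) w = f w := by
  have : w ≠ [] := by rintro rfl; simp [depth] at h
  rw [aux_sub_apply, one_apply, if_neg this, sub_zero]

lemma auxGood_Msub (D : ℕ) {f : NCS K} (h : ∀ n, (f - 1) (List.replicate n 0) = 0) :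
    auxGood (Msub D f) 1 D (f - 1) := by
  intro w
  refine ⟨((auxGood_zero (N := Msub D f) h) w).1, fun hw => ?_⟩
  by_cases hd : depth w = 0
  · rw [((auxGood_zero (N := Msub D f) h) w).1 (by omega)]; exact Submodule.zero_mem _
  · rw [aux_sub_one (by omega)]; exact aux_mem_Msub w (by omega) hw

/-- The main argument, from the special automorphism equation. -/
lemma aux_main (F G : NCS K) (hF0 : ∀ n, (F - 1) (List.replicate n 0) = 0)
    (hF1 : ∀ n, (F - 1) (List.replicate n 1) = 0)
    (hG0 : ∀ n, (G - 1) (List.replicate n 0) = 0)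
    (hE : E0 + F⁻¹ * E1 * F + G⁻¹ * Einf * G = 0) (D : ℕ) :
    Msub D F = Msub (D + 1) G := by
  have hFn : F [] = 1 := by
    have := hF0 0
    simpa [aux_sub_apply, one_apply, sub_eq_zero] using this
  have hGn : G [] = 1 := by
    have := hG0 0
    simpa [aux_sub_apply, one_apply, sub_eq_zero] using this
  have hFi := aux_inv_mul hFn
  have hG1 := aux_mul_inv hGn
  have hE2 : G * E0 + G * F⁻¹ * E1 * F - E0 * G - E1 * G = 0 := by
    have h1 : G * (E0 + F⁻¹ * E1 * F + G⁻¹ * Einf * G) = 0 := by rw [hE, mul_zero]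
    have h2 : G * (G⁻¹ * Einf * G) = Einf * G := by
      rw [mul_assoc, ← mul_assoc, hG1, one_mul]
    rw [mul_add, mul_add, h2, Einf] at h1
    rw [← h1]
    noncomm_ring
  obtain ⟨φ, hφ⟩ : ∃ φ, φ = F - 1 := ⟨_, rfl⟩
  obtain ⟨ψ, hψ⟩ : ∃ ψ, ψ = F⁻¹ - 1 := ⟨_, rfl⟩
  obtain ⟨χ, hχ⟩ : ∃ χ, χ = G - 1 := ⟨_, rfl⟩
  have eF : F = 1 + φ := by rw [hφ]; abel
  have eI : F⁻¹ = 1 + ψ := by rw [hψ]; abel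
  have eG : G = 1 + χ := by rw [hχ]; abel
  have hψφ : ψ = -φ - ψ * φ := by
    have h1 : (1 + ψ) * (1 + φ) = 1 := by rw [← eI, ← eF, hFi]
    have h2 : ψ + φ + ψ * φ = (1 + ψ) * (1 + φ) - 1 := by noncomm_ring
    rw [h1, sub_self] at h2
    rw [← sub_eq_zero, ← h2]; abel
  have hP : E0 * χ - χ * E0 = E1 * φ + (χ + ψ + χ * ψ) * E1 + (χ + ψ + χ * ψ) * E1 * φ
      - E1 * χ := by
    rw [eI, eF, eG] at hE2
    rw [← sub_eq_zero, ← neg_eq_zero, ← hE2]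
    noncomm_ring
  have gI : ∀ (N : Submodule ℤ K) (_ : ∀ x ∈ N, ∀ y ∈ N, x * y ∈ N) (j : ℕ),
      auxGood N 1 j φ → auxGood N 1 j ψ := by
    intro N hN j h
    rw [hψ]
    rw [hφ] at h
    exact auxGood_inv hN hFn h
  rw [← hφ] at hF0 hF1
  rw [← hχ] at hG0
  apply le_antisymm
  · -- from the series at infinity
    have hN := aux_Msub_mul (D + 1) G
    have gχ : auxGood (Msub (D + 1) G) 1 (D + 1) χ := by
      rw [hχ]; rw [hχ] at hG0; exact auxGood_Msub _ hG0
    generalize Msub (D + 1) G = N at hN gχ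
    have main : ∀ j, j ≤ D → auxGood N 1 j φ := by
      intro j
      induction j with
      | zero => exact fun _ => auxGood_zero hF0
      | succ j ih =>
          intro hj
          have gφ := ih (by omega)
          have gψ := gI N hN j gφ
          have gχψ : auxGood N 1 (j + 1) (χ * ψ) :=
            (auxGood.mul hN gχ gψ (D := j + 1) (by omega) (by omega)).mono (by omega) le_rfl
          have gψφ : auxGood N 1 (j + 1) (ψ * φ) :=
            (auxGood.mul hN gψ gφ (D := j + 1) (by omega) (by omega)).mono (by omega) le_rfl
          have gθ : auxGood N 1 j (χ + ψ + χ * ψ) :=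
            ((gχ.mono le_rfl (by omega)).add gψ).add (gχψ.mono le_rfl (by omega))
          have gt : auxGood N 0 (j + 2) ((χ + ψ + χ * ψ) * E1 * φ) :=
            (auxGood.mul hN gθ.mul_E1 gφ (D := j + 2) (by omega) (by omega)).mono (by omega) le_rfl
          have g0 : auxGood N 0 (j + 2) (χ * E1) := gχ.mul_E1.mono (by omega) (by omega)
          have g1 : auxGood N 0 (j + 2) (E1 * χ) := gχ.E1_mul.mono (by omega) (by omega)
          have g2 : auxGood N 0 (j + 2) (χ * ψ * E1) := gχψ.mul_E1.mono (by omega) (by omega)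
          have g3 : auxGood N 0 (j + 2) (ψ * φ * E1) := gψφ.mul_E1.mono (by omega) (by omega)
          have g4 : auxGood N 0 (j + 2) (E0 * χ - χ * E0) :=
            (gχ.E0_mul.sub gχ.mul_E0).mono (by omega) (by omega)
          refine auxGood_of_comm1 hF0 hF1 (m := j + 1) ?_
          have e : E1 * φ - φ * E1 = (E0 * χ - χ * E0) - χ * E1 + ψ * φ * E1 - χ * ψ * E1
              - (χ + ψ + χ * ψ) * E1 * φ + E1 * χ := by
            have e2 : ψ * E1 = - (φ * E1) - ψ * φ * E1 := by
              conv_lhs => rw [hψφ]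
              noncomm_ring
            rw [hP, add_mul, add_mul, e2]
            abel
          rw [e]
          exact ((((g4.sub g0).add g3).sub g2).sub gt).add g1
    have gφ := main D le_rfl
    refine aux_Msub_le hN fun w h1 h2 => ?_
    rw [← aux_sub_one (f := F) h1, ← hφ]
    exact (gφ w).2 h2
  · have hN := aux_Msub_mul D F
    have gφ : auxGood (Msub D F) 1 D φ := by
      rw [hφ]; rw [hφ] at hF0; exact auxGood_Msub _ hF0
    generalize Msub D F = N at hN gφ
    have gψ := gI N hN D gφ
    have main : ∀ j, j ≤ D + 1 → auxGood N 1 j χ := by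
      intro j
      induction j with
      | zero => exact fun _ => auxGood_zero hG0
      | succ j ih =>
          intro hj
          have gχ := ih (by omega)
          have gφ' := gφ.mono (r' := 1) (D' := j) le_rfl (by omega)
          have gψ' := gψ.mono (r' := 1) (D' := j) le_rfl (by omega)
          have gχψ : auxGood N 1 j (χ * ψ) :=
            (auxGood.mul hN gχ gψ' (D := j) (by omega) (by omega)).mono (by omega) le_rfl
          have gθ : auxGood N 1 j (χ + ψ + χ * ψ) := (gχ.add gψ').add gχψ
          have gt : auxGood N 0 (j + 1) ((χ + ψ + χ * ψ) * E1 * φ) :=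
            (auxGood.mul hN gθ.mul_E1 gφ' (D := j + 1) (by omega) (by omega)).mono (by omega) le_rfl
          refine auxGood_of_comm0 hG0 (m := j + 1) ?_
          rw [hP]
          exact (((gφ'.E1_mul.mono (by omega) le_rfl).add (gθ.mul_E1.mono (by omega) le_rfl)).add
            gt).sub (gχ.E1_mul.mono (by omega) le_rfl)
    have gχ := main (D + 1) le_rfl
    refine aux_Msub_le hN fun w h1 h2 => ?_
    rw [← aux_sub_one (f := G) h1, ← hχ]
    exact (gχ w).2 h2

end aux

section aux2
variable {K : Type*} [Field K] [CharZero K]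

lemma aux_rep_zero {f : NCS K} (hf : IsPi f) (c : Fin 2) (hc : f [c] = 0) (n : ℕ) :
    f (List.replicate (n + 1) c) = 0 := by
  have h := hf.2 [c] (List.replicate n c)
  rw [aux_shuf_rep, hc, zero_mul] at h
  have : ((n : K) + 1) ≠ 0 := by exact_mod_cast Nat.succ_ne_zero n
  exact (mul_eq_zero.1 h).resolve_left this

lemma aux_sub_one_rep {f : NCS K} (h0 : f [] = 1) (c : Fin 2)
    (h : ∀ n, f (List.replicate (n + 1) c) = 0) (n : ℕ) :
    (f - 1) (List.replicate n c) = 0 := by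
  rw [aux_sub_apply, one_apply]
  cases n with
  | zero => simp [h0]
  | succ n => rw [h]; simp

lemma aux_inf_rep {f : NCS K} (hf : IsPiT f) (n : ℕ) :
    subst E0 Einf f (List.replicate (n + 1) 0) = 0 := by
  rw [aux_subst_rep, auxG_T]
  refine Finset.sum_eq_zero fun j hj => ?_
  have hj' : j ≤ n + 1 := by simp at hj; omega
  obtain ⟨a, ha⟩ := Nat.exists_eq_add_of_le' hj'
  rw [auxT_S, ha, auxT_shuf, hf.1.2]
  cases a with
  | succ a => rw [aux_rep_zero hf.1 0 hf.2.1]; simp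
  | zero =>
      cases j with
      | zero => omega
      | succ j => rw [aux_rep_zero hf.1 1 hf.2.2]; simp

lemma aux_inf_nil {f : NCS K} (hf : IsPiT f) : subst E0 Einf f [] = 1 := by
  have := aux_subst_rep f 0
  rw [List.replicate_zero] at this
  rw [this]
  simp [auxG, auxS, depth, hf.1.1]

end aux2
end NCS

open NCS in
/-- main theorem, `μ = 0`: equality of the modules of coefficients
`M_{d-1}(Φ) = M_d(Φ∞)` for a solution of the one-dimensional associator equations. -/
theorem stmt_12 {K : Type*} [Field K] [CharZero K] (Φ : NCS K) (hΦ : IsPiT Φ)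
    (h : OneDim0 Φ) (Φinf : NCS K) (hinf : Φinf = subst E0 Einf Φ) :
    (∀ d : ℕ, 1 ≤ d → Msub (d - 1) Φ = Msub d Φinf) ∧
    Msub 1 Φinf = ⊥ ∧
    (∀ w : Word, depth w = 1 → Φinf w = 0) := by
  subst hinf
  have main : ∀ D, Msub D Φ = Msub (D + 1) (NCS.subst E0 Einf Φ) :=
    aux_main Φ (NCS.subst E0 Einf Φ)
      (aux_sub_one_rep hΦ.1.1 0 (aux_rep_zero hΦ.1 0 hΦ.2.1))
      (aux_sub_one_rep hΦ.1.1 1 (aux_rep_zero hΦ.1 1 hΦ.2.2))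
      (aux_sub_one_rep (aux_inf_nil hΦ) 0 (aux_inf_rep hΦ)) h.2.2
  have hbot : Msub 1 (NCS.subst E0 Einf Φ) = ⊥ := by
    rw [← main 0, eq_bot_iff]
    refine aux_Msub_le ?_ fun w h1 h2 => by omega
    intro x hx y _
    rw [Submodule.mem_bot] at hx ⊢
    rw [hx, zero_mul]
  refine ⟨fun d hd => ?_, hbot, fun w hw => ?_⟩
  · obtain ⟨D, rfl⟩ := Nat.exists_eq_add_of_le' hd
    exact main D
  · have := aux_mem_Msub (D := 1) (f := NCS.subst E0 Einf Φ) w (by omega) (by omega)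
    rwa [hbot, Submodule.mem_bot] at this
end

section
/- Let μ ∈ K and let Φ ∈ Π̃(K) satisfy the one-dimensional associator equations (with μ = 0 in the degenerate case, or with coupling constant μ if μ ≠ 0). Then for all d ≥ 1 and all s_d,…,s_1 ≥ 1 such that s_d+⋯+s_1 − d is odd, the coefficient Φ[e0^{s_d−1} e1 e0^{s_{d−1}−1} e1 ⋯ e0^{s_1−1} e1] belongs to the ℚ-subalgebra of K generated by μ together with the coefficients Φ[v] over all words v of depth at most d−1 (parity depth reduction). -/
namespace NCS.ParityAux

lemma depth_append (u v : Word) : depth (u ++ v) = depth u + depth v := by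
  simp [depth]

lemma depth_split (w : Word) (i : ℕ) : depth (w.take i) + depth (w.drop i) = depth w := by
  rw [← depth_append, List.take_append_drop]

lemma depth_cons0 (w : Word) : depth (0 :: w) = depth w := by
  simp [depth]

lemma depth_cons1 (w : Word) : depth (1 :: w) = depth w + 1 := by
  simp [depth]

lemma neg_apply {K : Type*} [CommRing K] (f : NCS K) (w : Word) : (-f) w = -(f w) := rfl

lemma sub_apply {K : Type*} [CommRing K] (f g : NCS K) (w : Word) :
    (f - g) w = f w - g w := by
  rw [sub_eq_add_neg, add_apply, neg_apply, sub_eq_add_neg]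

lemma sum_apply {K : Type*} [CommRing K] {ι : Type*} (s : Finset ι) (f : ι → NCS K) (w : Word) :
    (∑ i ∈ s, f i) w = ∑ i ∈ s, f i w := by
  classical
  induction s using Finset.induction_on with
  | empty => simp [zero_apply]
  | insert a s ha ih => rw [Finset.sum_insert ha, Finset.sum_insert ha, add_apply, ih]

lemma smul_mul_l {K : Type*} [CommRing K] (c : K) (f g : NCS K) :
    (c • f) * g = c • (f * g) := by
  funext w
  simp [mul_apply, smul_apply, Finset.mul_sum, mul_assoc]

lemma smul_mul_r {K : Type*} [CommRing K] (c : K) (f g : NCS K) :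
    f * (c • g) = c • (f * g) := by
  funext w
  simp only [mul_apply, smul_apply, Finset.mul_sum]
  exact Finset.sum_congr rfl fun i _ => by ring

lemma smul_pow' {K : Type*} [CommRing K] (c : K) (f : NCS K) (k : ℕ) :
    (c • f) ^ k = c ^ k • f ^ k := by
  induction k with
  | zero => funext w; simp [smul_apply]
  | succ k ih =>
    rw [pow_succ, ih, smul_mul_l, smul_mul_r, pow_succ, pow_succ]
    funext w
    simp only [smul_apply]; ring

/-- The projection `e1 ↦ 0`. -/
def pi0 {K : Type*} [CommRing K] : NCS K →+* NCS K where
  toFun f := fun w => if depth w = 0 then f w else 0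
  map_one' := by
    funext w
    cases w with
    | nil => simp [depth, one_apply]
    | cons a w => simp [one_apply]
  map_zero' := by
    funext w; simp [zero_apply]
  map_add' f g := by
    funext w
    show (if depth w = 0 then f w + g w else 0) =
      (if depth w = 0 then f w else 0) + (if depth w = 0 then g w else 0)
    by_cases h : depth w = 0
    · rw [if_pos h, if_pos h, if_pos h]
    · rw [if_neg h, if_neg h, if_neg h, add_zero]
  map_mul' f g := by
    funext w
    simp only [mul_apply]
    by_cases h : depth w = 0
    · rw [if_pos h]
      refine Finset.sum_congr rfl fun i _ => ?_
      have := depth_split w i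
      beta_reduce
      rw [if_pos (by omega), if_pos (by omega)]
    · rw [if_neg h]
      refine (Finset.sum_eq_zero fun i _ => ?_).symm
      have := depth_split w i
      beta_reduce
      by_cases h1 : depth (w.take i) = 0
      · rw [if_neg (show ¬ depth (w.drop i) = 0 by omega), mul_zero]
      · rw [if_neg h1, zero_mul]

lemma pi0_apply {K : Type*} [CommRing K] (f : NCS K) (w : Word) :
    pi0 f w = if depth w = 0 then f w else 0 := rfl

lemma pi0_smul {K : Type*} [CommRing K] (c : K) (f : NCS K) : pi0 (c • f) = c • pi0 f := by
  funext w; simp only [pi0_apply, smul_apply]; split_ifs <;> simp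

lemma pi0_E0 {K : Type*} [CommRing K] : pi0 (E0 : NCS K) = E0 := by
  funext w
  simp only [pi0_apply, E0]
  by_cases h : w = [0]
  · subst h; simp [depth]
  · simp [h]

lemma pi0_E1 {K : Type*} [CommRing K] : pi0 (E1 : NCS K) = 0 := by
  funext w
  simp only [pi0_apply, E1]
  by_cases h : w = [1]
  · subst h; simp [depth, zero_apply]
  · simp [h, zero_apply]

lemma pi0_Einf {K : Type*} [CommRing K] : pi0 (Einf : NCS K) = -E0 := by
  rw [Einf, map_sub, map_neg, pi0_E0, pi0_E1, sub_zero]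

lemma pi0_exp {K : Type*} [Field K] (x : NCS K) : pi0 (expS x) = expS (pi0 x) := by
  funext w
  simp only [pi0_apply, expS, ← map_pow]
  split_ifs <;> simp

/-- divided exponential -/
def gS {K : Type*} [Field K] (ν : K) (x : NCS K) : NCS K :=
  fun w => ∑ k ∈ Finset.range w.length, ((Nat.factorial (k + 1) : K)⁻¹ * ν ^ k) * (x ^ (k + 1)) w

lemma exp_eq_gS {K : Type*} [Field K] (ν : K) (x : NCS K) :
    expS (ν • x) = 1 + ν • gS ν x := by
  funext w
  simp only [expS, add_apply, smul_apply, gS, smul_pow', Finset.sum_range_succ', Finset.mul_sum]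
  rw [add_comm]
  congr 1
  · simp
  · exact Finset.sum_congr rfl fun i _ => by ring

lemma pi0_gS {K : Type*} [Field K] (ν : K) (x : NCS K) : pi0 (gS ν x) = gS ν (pi0 x) := by
  funext w
  simp only [pi0_apply, gS, ← map_pow]
  split_ifs <;> simp

lemma gS_zero {K : Type*} [Field K] (ν : K) : gS ν (0 : NCS K) = 0 := by
  funext w
  simp [gS, zero_apply]

lemma gS_zero_left {K : Type*} [Field K] (x : NCS K) (hx : x [] = 0) : gS 0 x = x := by
  funext w
  cases w with
  | nil => simp [gS, hx]
  | cons a w => simp [gS, Finset.sum_range_succ']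

lemma exp_zero_smul {K : Type*} [Field K] (x : NCS K) : expS ((0 : K) • x) = 1 := by
  rw [exp_eq_gS]
  funext w; simp [add_apply, smul_apply]

lemma exp_smul_zero {K : Type*} [Field K] (c : K) : expS (c • (0 : NCS K)) = 1 := by
  rw [exp_eq_gS, gS_zero]
  funext w; simp [add_apply, smul_apply, zero_apply]

lemma E0_mul_cons {K : Type*} [CommRing K] (g : NCS K) (a : Fin 2) (w : Word) :
    ((E0 : NCS K) * g) (a :: w) = if a = 0 then g w else 0 := by
  rw [cons_mul]
  have : shift a (E0 : NCS K) = if a = 0 then 1 else 0 := by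
    funext v
    by_cases h : a = 0 <;> simp [shift, E0, h, one_apply, zero_apply]
  rw [this]
  split_ifs <;> simp [E0, zero_apply]

lemma E0_pow {K : Type*} [CommRing K] (k : ℕ) (w : Word) :
    ((E0 : NCS K) ^ k) w = if depth w = 0 ∧ w.length = k then 1 else 0 := by
  induction k generalizing w with
  | zero =>
    cases w <;> simp [one_apply, depth]
  | succ k ih =>
    rw [pow_succ']
    cases w with
    | nil => simp [mul_nil, E0]
    | cons a w =>
      rw [E0_mul_cons, ih]
      fin_cases a
      · simp [depth]
        rfl
      · simp [depth]

lemma exp_E0 {K : Type*} [Field K] (c : K) (w : Word) :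
    expS (c • (E0 : NCS K)) w =
      if depth w = 0 then (Nat.factorial w.length : K)⁻¹ * c ^ w.length else 0 := by
  simp only [expS, smul_pow', smul_apply, E0_pow]
  split_ifs with h
  · rw [Finset.sum_eq_single w.length]
    · simp [h]
    · intro b _ hb
      simp [hb.symm]
    · intro hb
      simp at hb
  · simp [h]

lemma exp_mul_neg {K : Type*} [Field K] [CharZero K] (c : K) :
    expS (c • (E0 : NCS K)) * expS ((-c) • (E0 : NCS K)) = 1 := by
  have key : pi0 (expS (c • (E0 : NCS K)) * expS ((-c) • (E0 : NCS K))) =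
      expS (c • (E0 : NCS K)) * expS ((-c) • (E0 : NCS K)) := by
    rw [map_mul, pi0_exp, pi0_exp, pi0_smul, pi0_smul, pi0_E0]
  rw [← key]
  funext w
  rw [pi0_apply]
  split_ifs with h
  · rw [mul_apply]
    have : ∀ i ∈ Finset.range (w.length + 1),
        expS (c • (E0 : NCS K)) (w.take i) * expS ((-c) • (E0 : NCS K)) (w.drop i) =
        (Nat.factorial w.length : K)⁻¹ * (c ^ i * (-c) ^ (w.length - i) * (w.length.choose i)) := by
      intro i hi
      have hi' : i ≤ w.length := by simpa [Nat.lt_succ_iff] using hi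
      have := depth_split w i
      rw [exp_E0, exp_E0, if_pos (by omega), if_pos (by omega), List.length_take, List.length_drop,
        min_eq_left hi', Nat.cast_choose K hi']
      have h1 : (Nat.factorial w.length : K) ≠ 0 := by exact_mod_cast Nat.factorial_ne_zero _
      have h2 : (Nat.factorial i : K) ≠ 0 := by exact_mod_cast Nat.factorial_ne_zero _
      have h3 : (Nat.factorial (w.length - i) : K) ≠ 0 := by exact_mod_cast Nat.factorial_ne_zero _
      field_simp
    rw [Finset.sum_congr rfl this, ← Finset.mul_sum, ← add_pow, add_neg_cancel, one_apply]
    cases w <;> simp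
  · rw [one_apply, if_neg]
    rintro rfl
    exact h rfl

/-! ### inverse -/

lemma pow_vanish {K : Type*} [CommRing K] (u : NCS K) (hu : u [] = 0) (k : ℕ) (w : Word)
    (h : w.length < k) : (u ^ k) w = 0 := by
  induction k generalizing w with
  | zero => omega
  | succ k ih =>
    rw [pow_succ', mul_apply]
    refine Finset.sum_eq_zero fun i hi => ?_
    rcases Nat.eq_zero_or_pos i with rfl | hi0
    · simp [hu]
    · by_cases hw : i ≤ w.length
      · rw [ih, mul_zero]
        rw [List.length_drop]; omega
      · simp at hi; omega

lemma inv_agree {K : Type*} [CommRing K] (f : NCS K) (hf : f [] = 1) (N : ℕ) (w : Word)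
    (h : w.length ≤ N) : f⁻¹ w = (∑ k ∈ Finset.range (N + 1), (1 - f) ^ k) w := by
  rw [sum_apply]
  show ∑ k ∈ Finset.range (w.length + 1), ((1 - f) ^ k) w = _
  refine Finset.sum_subset (by intro x; simp; omega) ?_
  intro k _ hk
  apply pow_vanish
  · simp [sub_apply, one_apply, hf]
  · simp at hk; omega

lemma mul_inv_S {K : Type*} [CommRing K] (f : NCS K) (hf : f [] = 1) : f * f⁻¹ = 1 := by
  funext w
  have h1 : (f * f⁻¹) w = (f * ∑ k ∈ Finset.range (w.length + 1), (1 - f) ^ k) w := by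
    rw [mul_apply, mul_apply]
    refine Finset.sum_congr rfl fun i _ => ?_
    rw [inv_agree f hf w.length]
    rw [List.length_drop]; omega
  have h2 := mul_neg_geom_sum (1 - f) (w.length + 1)
  rw [sub_sub_cancel] at h2
  rw [h1, h2, sub_apply, pow_vanish, sub_zero]
  · simp [sub_apply, one_apply, hf]
  · omega

lemma inv_mul_S {K : Type*} [CommRing K] (f : NCS K) (hf : f [] = 1) : f⁻¹ * f = 1 := by
  funext w
  have h1 : (f⁻¹ * f) w = ((∑ k ∈ Finset.range (w.length + 1), (1 - f) ^ k) * f) w := by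
    rw [mul_apply, mul_apply]
    refine Finset.sum_congr rfl fun i _ => ?_
    rw [inv_agree f hf w.length]
    rw [List.length_take]; omega
  have h2 := geom_sum_mul_neg (1 - f) (w.length + 1)
  rw [sub_sub_cancel] at h2
  rw [h1, h2, sub_apply, pow_vanish, sub_zero]
  · simp [sub_apply, one_apply, hf]
  · omega

/-! ### linear substitutions -/

/-- Linear substitution, recursive form: `m c a` is the coefficient of the letter `a` in the
image of the letter `c`. -/
def lsub {K : Type*} [CommRing K] (m : Fin 2 → Fin 2 → K) : Word → NCS K → K
  | [], f => f []
  | a :: v, f => m 0 a * lsub m v (shift 0 f) + m 1 a * lsub m v (shift 1 f)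

/-- Linear form with given coefficients. -/
def lin {K : Type*} [CommRing K] (p : Fin 2 → K) : NCS K := p 0 • E0 + p 1 • E1

lemma E1_mul_cons {K : Type*} [CommRing K] (g : NCS K) (a : Fin 2) (w : Word) :
    ((E1 : NCS K) * g) (a :: w) = if a = 1 then g w else 0 := by
  rw [cons_mul]
  have : shift a (E1 : NCS K) = if a = 1 then 1 else 0 := by
    funext v
    by_cases h : a = 1 <;> simp [shift, E1, h, one_apply, zero_apply]
  rw [this]
  split_ifs <;> simp [E1, zero_apply]

lemma lin_mul_cons {K : Type*} [CommRing K] (p : Fin 2 → K) (g : NCS K) (a : Fin 2) (w : Word) :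
    (lin p * g) (a :: w) = p a * g w := by
  rw [lin, add_mul, add_apply, smul_mul_l, smul_mul_l, smul_apply, smul_apply, E0_mul_cons,
    E1_mul_cons]
  fin_cases a <;> simp

lemma lin_nil {K : Type*} [CommRing K] (p : Fin 2 → K) : lin p [] = 0 := by
  simp [lin, add_apply, smul_apply, E0, E1]

lemma mem_wordsLe (n : ℕ) (w : Word) : w ∈ wordsLe n ↔ w.length ≤ n := by
  simp only [wordsLe, Finset.mem_biUnion, Finset.mem_range, Finset.mem_image, Finset.mem_univ,
    true_and]
  constructor
  · rintro ⟨k, hk, t, rfl⟩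
    simp; omega
  · intro h
    exact ⟨w.length, by omega, w.get, List.ofFn_get w⟩

lemma sum_wordsLe_succ {M : Type*} [AddCommMonoid M] (n : ℕ) (F : Word → M) :
    ∑ w ∈ wordsLe (n + 1), F w = F [] + (∑ w ∈ wordsLe n, F (0 :: w) + ∑ w ∈ wordsLe n, F (1 :: w)) := by
  classical
  have h : wordsLe (n + 1) = insert [] ((wordsLe n).image (fun w => (0 : Fin 2) :: w) ∪
      (wordsLe n).image (fun w => (1 : Fin 2) :: w)) := by
    ext w
    cases w with
    | nil => simp [mem_wordsLe]
    | cons a w => fin_cases a <;> simp [mem_wordsLe]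
  rw [h, Finset.sum_insert, Finset.sum_union, Finset.sum_image, Finset.sum_image]
  · intro x _ y _ hxy; simpa using hxy
  · intro x _ y _ hxy; simpa using hxy
  · rw [Finset.disjoint_left]
    intro x hx hy
    simp only [Finset.mem_image] at hx hy
    obtain ⟨u, _, rfl⟩ := hx
    obtain ⟨v, _, hv⟩ := hy
    simp at hv
  · simp

lemma subst_eq_lsub {K : Type*} [CommRing K] (m : Fin 2 → Fin 2 → K) (f : NCS K) (v : Word) :
    NCS.subst (lin (m 0)) (lin (m 1)) f v = lsub m v f := by
  induction v generalizing f with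
  | nil =>
    have : wordsLe 0 = {[]} := by
      ext w; simp [mem_wordsLe]
    simp [NCS.subst, lsub, this, prodWord, one_apply]
  | cons a v ih =>
    simp only [lsub, ← ih]
    simp only [NCS.subst, List.length_cons, sum_wordsLe_succ, Finset.mul_sum]
    have h0 : ∀ w, prodWord (lin (m 0)) (lin (m 1)) (0 :: w) =
      lin (m 0) * prodWord (lin (m 0)) (lin (m 1)) w := by intro w; simp [prodWord]
    have h1 : ∀ w, prodWord (lin (m 0)) (lin (m 1)) (1 :: w) =
      lin (m 1) * prodWord (lin (m 0)) (lin (m 1)) w := by intro w; simp [prodWord]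
    simp only [h0, h1, lin_mul_cons]
    have h2 : prodWord (lin (m 0)) (lin (m 1)) [] (a :: v) = 0 := by simp [prodWord, one_apply]
    rw [h2, mul_zero, zero_add]
    congr 1 <;> exact Finset.sum_congr rfl fun i _ => by simp only [shift]; ring

lemma lsub_add {K : Type*} [CommRing K] (m : Fin 2 → Fin 2 → K) (v : Word) (f g : NCS K) :
    lsub m v (f + g) = lsub m v f + lsub m v g := by
  induction v generalizing f g with
  | nil => rfl
  | cons a v ih =>
    have h : ∀ c, shift c (f + g) = shift c f + shift c g := fun c => rfl
    simp only [lsub, h, ih]; ring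

lemma lsub_smul {K : Type*} [CommRing K] (m : Fin 2 → Fin 2 → K) (v : Word) (c : K) (f : NCS K) :
    lsub m v (c • f) = c * lsub m v f := by
  induction v generalizing f with
  | nil => rfl
  | cons a v ih =>
    have h : ∀ b, shift b (c • f) = c • shift b f := fun b => rfl
    simp only [lsub, h, ih]; ring

/-- `lsub` as a series. -/
def lsubS {K : Type*} [CommRing K] (m : Fin 2 → Fin 2 → K) (f : NCS K) : NCS K :=
  fun v => lsub m v f

lemma lsub_mul {K : Type*} [CommRing K] (m : Fin 2 → Fin 2 → K) (f g : NCS K) :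
    lsubS m (f * g) = lsubS m f * lsubS m g := by
  funext v
  show lsub m v (f * g) = _
  induction v generalizing f g with
  | nil => simp [lsub, mul_nil, lsubS]
  | cons a v ih =>
    have h : ∀ b, shift b (f * g) = f [] • shift b g + shift b f * g := by
      intro b; funext w; exact cons_mul f g b w
    have h2 : shift a (lsubS m f) = m 0 a • lsubS m (shift 0 f) + m 1 a • lsubS m (shift 1 f) := rfl
    rw [cons_mul, h2, add_mul, smul_mul_l, smul_mul_l]
    simp only [lsub, h, lsub_add, lsub_smul, ih, add_apply, smul_apply]
    simp only [lsubS, lsub]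
    ring

lemma lsub_one {K : Type*} [CommRing K] (m : Fin 2 → Fin 2 → K) : lsubS m (1 : NCS K) = 1 := by
  funext v
  cases v with
  | nil => rfl
  | cons a v =>
    have h : ∀ c, shift c (1 : NCS K) = (0 : K) • 1 := by
      intro c; funext w; simp [shift, one_apply, smul_apply]
    show lsub m (a :: v) 1 = _
    simp [lsub, h, lsub_smul, one_apply]

lemma lsub_comp {K : Type*} [CommRing K] (m n p : Fin 2 → Fin 2 → K)
    (hp : ∀ c a, p c a = n c 0 * m 0 a + n c 1 * m 1 a) (f : NCS K) :
    lsubS m (lsubS n f) = lsubS p f := by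
  funext v
  show lsub m v (lsubS n f) = lsub p v f
  induction v generalizing f with
  | nil => rfl
  | cons a v ih =>
    have h : ∀ b, shift b (lsubS n f) = n 0 b • lsubS n (shift 0 f) + n 1 b • lsubS n (shift 1 f) :=
      fun b => rfl
    simp only [lsub, h, lsub_add, lsub_smul, ih, hp]
    ring

lemma lsub_depth {K : Type*} [CommRing K] (m : Fin 2 → Fin 2 → K)
    (h00 : m 0 0 = -1) (h10 : m 1 0 = 0) (h01 : m 0 1 = -1) (h11 : m 1 1 = 1)
    (B : AddSubgroup K) (w : Word) (f : NCS K) (hf : ∀ v, depth v < depth w → f v ∈ B) :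
    lsub m w f - (-1) ^ (w.count 0) * f w ∈ B := by
  induction w generalizing f with
  | nil => simp [lsub]
  | cons a w ih =>
    fin_cases a
    · have := ih (shift 0 f) (fun v hv => hf _ (by simpa [depth_cons0] using hv))
      have h2 := B.neg_mem this
      have hc : List.count (0 : Fin 2) (0 :: w) = w.count 0 + 1 := by simp
      simp only [Fin.zero_eta, lsub, h00, h10, hc, pow_succ]
      convert h2 using 1
      simp only [shift]
      ring
    · have h1 := ih (shift 1 f) (fun v hv => hf _ (by
        simp only [Fin.mk_one, depth_cons1]; omega))
      have h2 := ih (shift 0 f) (fun v hv => hf _ (by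
        simp only [Fin.mk_one, depth_cons1, depth_cons0]; omega))
      have h3 : f (0 :: w) ∈ B := hf _ (by
        simp only [Fin.mk_one, depth_cons1, depth_cons0]; omega)
      have h4 : (-1) ^ (w.count 0) * f (0 :: w) ∈ B := by
        rcases neg_one_pow_eq_or K (w.count 0) with h | h <;> rw [h]
        · simpa using h3
        · simpa using h3
      have h5 := B.sub_mem (B.sub_mem h1 h2) h4
      have hc : List.count (0 : Fin 2) (1 :: w) = w.count 0 := by simp
      simp only [Fin.mk_one, lsub, h01, h11, hc]
      simp only [shift] at h5 ⊢
      convert h5 using 1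
      ring

/-! ### coefficients in a subalgebra up to a given depth -/

section coeffs

variable {K : Type*} [Field K] [CharZero K] (A : Subalgebra ℚ K)

/-- Series whose coefficients in depth `≤ m` lie in `A`. -/
def Rm (m : ℕ) : Subring (NCS K) where
  carrier := {f | ∀ w, depth w ≤ m → f w ∈ A}
  one_mem' := by
    intro w _
    rw [one_apply]; split_ifs
    · exact A.one_mem
    · exact A.zero_mem
  zero_mem' := fun w _ => A.zero_mem
  add_mem' := fun hf hg w hw => A.add_mem (hf w hw) (hg w hw)
  neg_mem' := fun hf w hw => A.neg_mem (hf w hw)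
  mul_mem' := by
    intro f g hf hg w hw
    rw [mul_apply]
    refine A.sum_mem fun i _ => ?_
    have := depth_split w i
    exact A.mul_mem (hf _ (by omega)) (hg _ (by omega))

variable {A}

lemma mem_Rm {m : ℕ} {f : NCS K} : f ∈ Rm A m ↔ ∀ w, depth w ≤ m → f w ∈ A := Iff.rfl

lemma Rm_mono {m n : ℕ} (h : m ≤ n) {f : NCS K} (hf : f ∈ Rm A n) : f ∈ Rm A m :=
  fun w hw => hf w (hw.trans h)

lemma Rm_smul {m : ℕ} {c : K} (hc : c ∈ A) {f : NCS K} (hf : f ∈ Rm A m) : c • f ∈ Rm A m :=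
  fun w hw => A.mul_mem hc (hf w hw)

lemma fact_mem (k : ℕ) : (Nat.factorial k : K)⁻¹ ∈ A := by
  have := A.algebraMap_mem ((Nat.factorial k : ℚ)⁻¹)
  simpa using this

lemma half_mem {x : K} (h : 2 * x ∈ A) : x ∈ A := by
  have := A.mul_mem (A.algebraMap_mem ((2 : ℚ)⁻¹)) h
  simpa using this

lemma E0_Rm (m : ℕ) : (E0 : NCS K) ∈ Rm A m := by
  intro w _
  simp only [E0]; split_ifs
  · exact A.one_mem
  · exact A.zero_mem

lemma E1_Rm (m : ℕ) : (E1 : NCS K) ∈ Rm A m := by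
  intro w _
  simp only [E1]; split_ifs
  · exact A.one_mem
  · exact A.zero_mem

lemma Einf_Rm (m : ℕ) : (Einf : NCS K) ∈ Rm A m :=
  sub_mem (neg_mem (E0_Rm m)) (E1_Rm m)

lemma exp_Rm {m : ℕ} {x : NCS K} (hx : x ∈ Rm A m) : expS x ∈ Rm A m := by
  intro w hw
  exact A.sum_mem fun k _ => A.mul_mem (fact_mem k) (pow_mem hx k w hw)

lemma gS_Rm {m : ℕ} {ν : K} (hν : ν ∈ A) {x : NCS K} (hx : x ∈ Rm A m) : gS ν x ∈ Rm A m := by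
  intro w hw
  exact A.sum_mem fun k _ => A.mul_mem (A.mul_mem (fact_mem _) (pow_mem hν k))
    (pow_mem hx _ w hw)

lemma inv_Rm {m : ℕ} {f : NCS K} (hf : f ∈ Rm A m) : f⁻¹ ∈ Rm A m := by
  intro w hw
  exact A.sum_mem fun k _ => pow_mem (sub_mem (one_mem _) hf) k w hw

/-- product lemma, general form -/
lemma prod_gen {d : ℕ} (hd : 1 ≤ d) {f g : NCS K} (hf : f ∈ Rm A (d - 1)) (hg : g ∈ Rm A (d - 1))
    (w : Word) (hw : depth w = d) :
    (f * g) w - (pi0 f * g) w - (f * pi0 g) w ∈ A := by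
  simp only [mul_apply, ← Finset.sum_sub_distrib]
  refine A.sum_mem fun i _ => ?_
  have := depth_split w i
  simp only [pi0_apply]
  by_cases h1 : depth (w.take i) = 0
  · rw [if_pos h1, if_neg (by omega)]; simp
  · by_cases h2 : depth (w.drop i) = 0
    · rw [if_neg h1, if_pos h2]; simp
    · rw [if_neg h1, if_neg h2]
      simpa using A.mul_mem (hf (w.take i) (by omega)) (hg (w.drop i) (by omega))

lemma prod_triv {d : ℕ} (hd : 1 ≤ d) {f g : NCS K} (hf : f ∈ Rm A (d - 1)) (hg : g ∈ Rm A (d - 1))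
    (hf1 : pi0 f = 1) (hg1 : pi0 g = 1) (w : Word) (hw : depth w = d) :
    (f * g) w - g w - f w ∈ A := by
  have := prod_gen hd hf hg w hw
  rwa [hf1, hg1, one_mul, mul_one] at this

lemma mul_pos_l {d : ℕ} (hd : 1 ≤ d) {f g : NCS K} (hf : f ∈ Rm A (d - 1)) (hg : g ∈ Rm A d)
    (hg0 : pi0 g = 0) : f * g ∈ Rm A d := by
  intro w hw
  rw [mul_apply]
  refine A.sum_mem fun i _ => ?_
  have := depth_split w i
  by_cases h2 : depth (w.drop i) = 0
  · have h3 := congrFun hg0 (w.drop i)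
    rw [pi0_apply, if_pos h2] at h3
    rw [h3, zero_apply, mul_zero]; exact A.zero_mem
  · exact A.mul_mem (hf _ (by omega)) (hg _ (by omega))

lemma mul_pos_r {d : ℕ} (hd : 1 ≤ d) {f g : NCS K} (hf : f ∈ Rm A (d - 1)) (hg : g ∈ Rm A d)
    (hg0 : pi0 g = 0) : g * f ∈ Rm A d := by
  intro w hw
  rw [mul_apply]
  refine A.sum_mem fun i _ => ?_
  have := depth_split w i
  by_cases h2 : depth (w.take i) = 0
  · have h3 := congrFun hg0 (w.take i)
    rw [pi0_apply, if_pos h2] at h3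
    rw [h3, zero_apply, zero_mul]; exact A.zero_mem
  · exact A.mul_mem (hg _ (by omega)) (hf _ (by omega))

lemma comm_lemma {d : ℕ} (hd : 1 ≤ d) {Z q : NCS K} (hq : q ∈ Rm A d) (hqpi : pi0 q = q)
    (hqnil : q [] = 0) (hq0 : q [0] = -1)
    (h : ∀ w, depth w = d → (Z * q) w - (q * Z) w ∈ A)
    (n : ℕ) (w : Word) (hn : w.length = n) (hw : depth w = d) (hlast : ∃ u, w = u ++ [1]) :
    Z w ∈ A := by
  induction n using Nat.strong_induction_on generalizing w with
  | _ n ih =>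
  have hqd : ∀ v, depth v ≠ 0 → q v = 0 := by
    intro v hv
    rw [← hqpi, pi0_apply, if_neg hv]
  have hdropdepth : ∀ i, i < w.length → depth (w.drop i) ≠ 0 ∧ ∃ u, w.drop i = u ++ [1] := by
    intro i hi
    obtain ⟨u, rfl⟩ := hlast
    simp only [List.length_append, List.length_singleton] at hi
    rw [List.drop_append_of_le_length (by omega)]
    exact ⟨by rw [depth_append]; simp [depth], _, rfl⟩
  have h1 := h (0 :: w) (by rw [depth_cons0, hw])
  have h2 : (Z * q) (0 :: w) = 0 := by
    rw [mul_apply]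
    refine Finset.sum_eq_zero fun i hi => ?_
    rcases Nat.lt_or_ge i (w.length + 1) with hlt | hge
    · have : depth ((0 :: w : Word).drop i) ≠ 0 := by
        cases i with
        | zero => simp only [List.drop_zero, depth_cons0]; omega
        | succ i => exact (hdropdepth i (by omega)).1
      rw [hqd _ this, mul_zero]
    · have : (0 :: w : Word).drop i = [] := List.drop_eq_nil_of_le (by simpa using hge)
      rw [this, hqnil, mul_zero]
  have h3 : (q * Z) (0 :: w) = (∑ i ∈ Finset.range w.length,
      q (0 :: w.take (i + 1)) * Z (w.drop (i + 1))) - Z w := by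
    rw [cons_mul, hqnil, zero_mul, zero_add, mul_apply, Finset.sum_range_succ']
    simp [shift, hq0, sub_eq_add_neg]
  have h4 : (∑ i ∈ Finset.range w.length,
      q (0 :: w.take (i + 1)) * Z (w.drop (i + 1))) ∈ A := by
    refine A.sum_mem fun i hi => ?_
    have hi' : i < w.length := by simpa using hi
    have hs := depth_split w (i + 1)
    by_cases ht : depth (w.take (i + 1)) = 0
    · rcases Nat.lt_or_ge (i + 1) w.length with hlt | hge
      · refine A.mul_mem (hq _ (by rw [depth_cons0]; omega)) ?_
        exact ih (w.drop (i + 1)).length (by rw [List.length_drop]; omega) _ rfl (by omega)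
          (hdropdepth _ hlt).2
      · rw [List.take_of_length_le hge] at ht
        omega
    · rw [hqd _ (by rwa [depth_cons0]), zero_mul]; exact A.zero_mem
  rw [h2, h3] at h1
  have := A.add_mem h1 h4
  simpa using this

end coeffs

/-! ### the core argument -/

lemma phi_e0 {K : Type*} [Field K] [CharZero K] (Φ : NCS K) (hΦ : IsPiT Φ) (n : ℕ) :
    Φ (List.replicate (n + 1) 0) = 0 := by
  induction n with
  | zero => exact hΦ.2.1
  | succ n ih =>
    have hsh : ∀ k, shuffle [0] (List.replicate k 0) =
        List.replicate (k + 1) (List.replicate (k + 1) 0) := by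
      intro k
      induction k with
      | zero => simp [shuffle]
      | succ k ihk =>
        rw [List.replicate_succ (n := k), shuffle, ihk]
        simp [shuffle, List.replicate_succ]
    have h := hΦ.1.2 [0] (List.replicate (n + 1) 0)
    rw [shufApply, hsh, hΦ.2.1, zero_mul] at h
    simp only [List.map_replicate, List.sum_replicate, nsmul_eq_mul] at h
    rcases mul_eq_zero.mp h with h | h
    · exact absurd h (Nat.cast_ne_zero.mpr (Nat.succ_ne_zero _))
    · exact h

lemma pi0_phi {K : Type*} [Field K] [CharZero K] (Φ : NCS K) (hΦ : IsPiT Φ) : pi0 Φ = 1 := by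
  funext w
  rw [pi0_apply, one_apply]
  cases w with
  | nil => simp [depth, hΦ.1.1]
  | cons a w =>
    split_ifs with h h2 h2
    · simp at h2
    · have : (a :: w : Word) = List.replicate (w.length + 1) 0 := by
        rw [List.eq_replicate_iff]
        refine ⟨by simp, fun b hb => ?_⟩
        have h3 : (1 : Fin 2) ∉ (a :: w : Word) := List.count_eq_zero.mp h
        by_contra hb0
        have : b = 1 := by omega
        exact h3 (this ▸ hb)
      rw [this, phi_e0 Φ hΦ]
    · simp at h2
    · rfl

/-- matrix of a pair of letters -/
def mat {K : Type*} [CommRing K] (a b c d : K) : Fin 2 → Fin 2 → K := ![![a, b], ![c, d]]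

lemma lin_E0 {K : Type*} [CommRing K] : lin (![1, 0] : Fin 2 → K) = E0 := by
  funext w; simp [lin, add_apply, smul_apply]

lemma lin_E1 {K : Type*} [CommRing K] : lin (![0, 1] : Fin 2 → K) = E1 := by
  funext w; simp [lin, add_apply, smul_apply]

lemma lin_Einf {K : Type*} [CommRing K] : lin (![-1, -1] : Fin 2 → K) = Einf := by
  funext w; simp [lin, add_apply, smul_apply, Einf, sub_apply, neg_apply, sub_eq_add_neg]

lemma subst_lin {K : Type*} [CommRing K] (p q : Fin 2 → K) (f : NCS K) :
    NCS.subst (lin p) (lin q) f = lsubS ![p, q] f := by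
  funext v
  exact subst_eq_lsub ![p, q] f v

lemma core {K : Type*} [Field K] [CharZero K] (μ : K) (Φ X X' Y' : NCS K) (hΦ : IsPiT Φ)
    (hXX' : X * X' = 1)
    (hY' : Y' = lsubS ![![-1, -1], ![0, 1]] Φ⁻¹)
    (hH : expS ((μ / 2) • E0) * X' * expS ((μ / 2) • Einf) * Y' * expS ((μ / 2) • E1) * Φ = 1)
    (hS : expS ((μ / 2) • E0) * X * expS ((-(μ / 2)) • E0) *
        (-gS (-μ) E0 - Φ⁻¹ * gS (-μ) E1 * Φ * expS ((-μ) • E0)) =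
      expS ((μ / 2) • E0) * gS μ Einf * expS ((-(μ / 2)) • E0) *
        (expS ((μ / 2) • E0) * X * expS ((-(μ / 2)) • E0)))
    (A : Subalgebra ℚ K) (hμ : μ ∈ A) (d : ℕ) (hd : 1 ≤ d)
    (hA : Φ ∈ Rm A (d - 1)) (w : Word) (hw : depth w = d) (hlast : ∃ u, w = u ++ [1])
    (hodd : Odd (w.count 0)) : Φ w ∈ A := by
  have hμ2 : μ / 2 ∈ A := half_mem (by simpa [mul_div_cancel₀] using hμ)
  have hμ2' : -(μ / 2) ∈ A := A.neg_mem hμ2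
  have hμ' : -μ ∈ A := A.neg_mem hμ
  have hee := exp_mul_neg (μ / 2)
  have he'e := exp_mul_neg (-(μ / 2))
  rw [neg_neg] at he'e
  have pe : pi0 (expS ((μ / 2) • (E0 : NCS K))) = expS ((μ / 2) • E0) := by
    rw [pi0_exp, pi0_smul, pi0_E0]
  have ph : pi0 (expS ((μ / 2) • (Einf : NCS K))) = expS ((-(μ / 2)) • E0) := by
    rw [pi0_exp, pi0_smul, pi0_Einf]
    congr 1
    funext v; simp [smul_apply, neg_apply]
  have pk : pi0 (expS ((μ / 2) • (E1 : NCS K))) = 1 := by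
    rw [pi0_exp, pi0_smul, pi0_E1, exp_smul_zero]
  have e0R : expS ((μ / 2) • (E0 : NCS K)) ∈ Rm A d := exp_Rm (Rm_smul hμ2 (E0_Rm d))
  have e0R' : expS ((-(μ / 2)) • (E0 : NCS K)) ∈ Rm A d := exp_Rm (Rm_smul hμ2' (E0_Rm d))
  have hR : expS ((μ / 2) • (Einf : NCS K)) ∈ Rm A d := exp_Rm (Rm_smul hμ2 (Einf_Rm d))
  have kR : expS ((μ / 2) • (E1 : NCS K)) ∈ Rm A d := exp_Rm (Rm_smul hμ2 (E1_Rm d))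
  have eμR : expS ((-μ) • (E0 : NCS K)) ∈ Rm A d := exp_Rm (Rm_smul hμ' (E0_Rm d))
  have pμ : pi0 (expS ((-μ) • (E0 : NCS K))) = expS ((-μ) • E0) := by
    rw [pi0_exp, pi0_smul, pi0_E0]
  have g0R : gS (-μ) (E0 : NCS K) ∈ Rm A d := gS_Rm hμ' (E0_Rm d)
  have g1R : gS (-μ) (E1 : NCS K) ∈ Rm A d := gS_Rm hμ' (E1_Rm d)
  have giR : gS μ (Einf : NCS K) ∈ Rm A d := gS_Rm hμ (Einf_Rm d)
  have pg0 : pi0 (gS (-μ) (E0 : NCS K)) = gS (-μ) E0 := by rw [pi0_gS, pi0_E0]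
  have pg1 : pi0 (gS (-μ) (E1 : NCS K)) = 0 := by rw [pi0_gS, pi0_E1, gS_zero]
  set e := expS ((μ / 2) • (E0 : NCS K)) with hedef
  set e' := expS ((-(μ / 2)) • (E0 : NCS K)) with he'def
  set h := expS ((μ / 2) • (Einf : NCS K))
  set k := expS ((μ / 2) • (E1 : NCS K))
  set t := expS ((-μ) • (E0 : NCS K))
  -- the inverse of Φ
  have hΨR : Φ⁻¹ ∈ Rm A (d - 1) := inv_Rm hA
  have hΦΨ := mul_inv_S Φ hΦ.1.1
  have pΦ := pi0_phi Φ hΦ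
  have pΨ : pi0 Φ⁻¹ = 1 := by
    have := congrArg pi0 hΦΨ
    rwa [map_mul, pΦ, one_mul, map_one] at this
  set Ψ := Φ⁻¹
  have hΨw : Ψ w + Φ w ∈ A := by
    have := prod_triv hd hA hΨR pΦ pΨ w hw
    rw [hΦΨ, one_apply, if_neg] at this
    · have := A.neg_mem this
      convert this using 1
      ring
    · rintro rfl; simp [depth] at hw; omega
  -- Y'
  have Yd : ∀ (B : AddSubgroup K) (v : Word), (∀ u, depth u < depth v → Ψ u ∈ B) →
      Y' v - (-1) ^ (v.count 0) * Ψ v ∈ B := by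
    intro B v hv
    rw [hY']
    exact lsub_depth _ (by simp) (by simp) (by simp) (by simp) B v Ψ hv
  have signA : ∀ n : ℕ, ∀ x ∈ A, (-1) ^ n * x ∈ A := fun n x hx =>
    A.mul_mem (pow_mem (A.neg_mem A.one_mem) n) hx
  have YR : Y' ∈ Rm A (d - 1) := by
    intro v hv
    have := Yd A.toSubring.toAddSubgroup v (fun u hu => hΨR u (by omega))
    have this : Y' v - (-1) ^ (v.count 0) * Ψ v ∈ A := this
    simpa using A.add_mem this (signA (v.count 0) _ (hΨR v hv))
  have pY : pi0 Y' = 1 := by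
    funext v
    rw [pi0_apply]
    split_ifs with hv
    · have := Yd ⊥ v (fun u hu => by omega)
      rw [AddSubgroup.mem_bot, sub_eq_zero] at this
      have h1 := congrFun pΨ v
      rw [pi0_apply, if_pos hv] at h1
      rw [this, h1, one_apply]
      cases v <;> simp
    · rw [one_apply, if_neg]
      rintro rfl; exact hv rfl
  have Yw : Y' w + Ψ w ∈ A := by
    have := Yd A.toSubring.toAddSubgroup w (fun u hu => hΨR u (by omega))
    have this : Y' w - (-1) ^ (w.count 0) * Ψ w ∈ A := this
    rw [hodd.neg_one_pow] at this
    convert this using 1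
    ring
  -- Z
  have hZ : e * X * e' = e * h * (Y' * (k * Φ)) := by
    have h1 : X * e' * (e * X' * h * Y' * k * Φ) = X * e' := by rw [hH, mul_one]
    have h2 : X * e' * (e * X' * h * Y' * k * Φ) = X * (e' * e) * X' * (h * (Y' * (k * Φ))) := by
      noncomm_ring
    rw [h2, he'e, mul_one, hXX', one_mul] at h1
    rw [mul_assoc e X e', ← h1]
    noncomm_ring
  set Z := e * X * e'
  have hmn : d - 1 ≤ d := Nat.sub_le _ _
  have kΦR : k * Φ ∈ Rm A (d - 1) := mul_mem (Rm_mono hmn kR) hA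
  have pkΦ : pi0 (k * Φ) = 1 := by rw [map_mul, pk, pΦ, one_mul]
  have YkR := mul_mem YR kΦR
  have pYk : pi0 (Y' * (k * Φ)) = 1 := by rw [map_mul, pkΦ, pY, one_mul]
  have ehR : e * h ∈ Rm A d := mul_mem e0R hR
  have peh : pi0 (e * h) = 1 := by rw [map_mul, pe, ph, hee]
  have ZR : Z ∈ Rm A (d - 1) := by rw [hZ]; exact mul_mem (Rm_mono hmn ehR) YkR
  have pZ : pi0 Z = 1 := by rw [hZ, map_mul, peh, pYk, one_mul]
  have Zw : Z w - (Y' w + Φ w) ∈ A := by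
    have z1 := prod_triv hd (Rm_mono hmn ehR) YkR peh pYk w hw
    have z2 := prod_triv hd YR kΦR pY pkΦ w hw
    have z3 := prod_triv hd (Rm_mono hmn kR) hA pk pΦ w hw
    have z4 := ehR w hw.le
    have z5 := kR w hw.le
    rw [← hZ] at z1
    convert A.add_mem (A.add_mem (A.add_mem (A.add_mem z1 z2) z3) z4) z5 using 1
    ring
  -- P and Q
  have PR : (-gS (-μ) E0 - Ψ * gS (-μ) E1 * Φ * t) ∈ Rm A d := by
    refine sub_mem (neg_mem g0R) (mul_mem ?_ eμR)
    exact mul_pos_r hd hA (mul_pos_l hd hΨR g1R pg1) (by rw [map_mul, pg1, mul_zero])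
  have QR : e * gS μ Einf * e' ∈ Rm A d := mul_mem (mul_mem e0R giR) e0R'
  have pP : pi0 (-gS (-μ) E0 - Ψ * gS (-μ) E1 * Φ * t) = -gS (-μ) E0 := by
    simp only [map_sub, map_neg, map_mul, pg0, pg1, mul_zero, zero_mul, sub_zero]
  set P := (-gS (-μ) E0 - Ψ * gS (-μ) E1 * Φ * t)
  set Q := e * gS μ Einf * e'
  have pQ : pi0 Q = -gS (-μ) E0 := by
    have := congrArg pi0 hS
    rw [map_mul pi0 Z P, map_mul pi0 Q Z, pZ, one_mul, mul_one, pP] at this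
    exact this.symm
  have hcomm : ∀ v, depth v = d →
      (Z * (-gS (-μ) E0)) v - ((-gS (-μ) E0) * Z) v ∈ A := by
    intro v hv
    have c1 := prod_gen hd ZR (Rm_mono hmn PR) v hv
    have c2 := prod_gen hd (Rm_mono hmn QR) ZR v hv
    rw [pZ, one_mul, pP] at c1
    rw [pZ, mul_one, pQ, ← hS] at c2
    have c3 := PR v hv.le
    have c4 := QR v hv.le
    convert A.sub_mem (A.add_mem (A.sub_mem c2 c1) c4) c3 using 1
    ring
  have hZA : Z w ∈ A := by
    refine comm_lemma hd (neg_mem g0R) (by rw [map_neg, pg0]) ?_ ?_ hcomm w.length w rfl hw hlast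
    · simp [neg_apply, gS]
    · simp [neg_apply, gS, E0]
  apply half_mem
  convert A.sub_mem (A.add_mem (A.sub_mem hZA Zw) hΨw) Yw using 1
  ring

lemma wordW_succ (d : ℕ) (s : ℕ → ℕ) : wordW (d + 1) s = blk (s (d + 1)) ++ wordW d s := by
  simp only [wordW, List.ofFn_succ, List.flatten_cons]
  congr 3
  funext j
  simp

lemma wordW_depth (d : ℕ) (s : ℕ → ℕ) : depth (wordW d s) = d := by
  induction d with
  | zero => simp [wordW, depth]
  | succ d ih =>
    rw [wordW_succ, depth_append, ih]
    simp [blk, depth, List.count_replicate]; omega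

lemma wordW_count (d : ℕ) (s : ℕ → ℕ) (hs : ∀ i, 1 ≤ i → i ≤ d → 1 ≤ s i) :
    (wordW d s).count 0 + d = ∑ i ∈ Finset.Icc 1 d, s i := by
  induction d with
  | zero => simp [wordW]
  | succ d ih =>
    have h1 := ih (fun i hi hid => hs i hi (by omega))
    have h2 := hs (d + 1) (by omega) le_rfl
    rw [wordW_succ, Finset.sum_Icc_succ_top (by omega), ← h1, List.count_append]
    simp [blk]; omega

lemma wordW_last (d : ℕ) (hd : 1 ≤ d) (s : ℕ → ℕ) : ∃ u, wordW d s = u ++ [1] := by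
  induction d with
  | zero => omega
  | succ d ih =>
    rw [wordW_succ]
    rcases Nat.eq_zero_or_pos d with rfl | h
    · exact ⟨List.replicate (s (0 + 1) - 1) 0, by simp [wordW, blk]⟩
    · obtain ⟨u, hu⟩ := ih h
      exact ⟨blk (s (d + 1)) ++ u, by rw [hu, List.append_assoc]⟩

lemma assoc_data {K : Type*} [Field K] (Φ : NCS K) (h1 : Φ [] = 1)
    (hD : NCS.subst E1 E0 Φ = Φ⁻¹) :
    NCS.subst E0 Einf Φ * NCS.subst Einf E0 Φ = 1 ∧
    NCS.subst E1 Einf Φ = lsubS ![![-1, -1], ![0, 1]] Φ⁻¹ := by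
  have hΦ := mul_inv_S Φ h1
  rw [← hD] at hΦ ⊢
  rw [← lin_E0, ← lin_E1, ← lin_Einf] at *
  simp only [subst_lin] at *
  constructor
  · have := congrArg (lsubS ![![1, 0], ![-1, -1]]) hΦ
    rw [lsub_mul, lsub_one, lsub_comp _ _ ![![-1, -1], ![1, 0]]] at this
    · exact this
    · intro c a; fin_cases c <;> fin_cases a <;> simp
  · rw [lsub_comp]
    intro c a; fin_cases c <;> fin_cases a <;> simp

lemma subst_nil {K : Type*} [Field K] (Φ : NCS K) (h1 : Φ [] = 1) :
    NCS.subst E0 Einf Φ [] = 1 := by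
  rw [← lin_E0, ← lin_Einf, subst_lin]
  exact h1

end NCS.ParityAux

open NCS in
/-- parity depth reduction: if the weight minus the depth is odd,
then `Φ[e0^{s_d-1}e1⋯e0^{s_1-1}e1]` reduces to depth `≤ d-1`. -/
theorem stmt_16 {K : Type*} [Field K] [CharZero K] (μ : K) (Φ : NCS K)
    (hΦ : IsPiT Φ)
    (h : (μ = 0 ∧ OneDim0 Φ) ∨ (μ ≠ 0 ∧ OneDimMu μ Φ))
    (d : ℕ) (hd : 1 ≤ d) (s : ℕ → ℕ) (hs : ∀ i, 1 ≤ i → i ≤ d → 1 ≤ s i)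
    (hodd : Odd ((∑ i ∈ Finset.Icc 1 d, s i) - d)) :
    Φ (wordW d s) ∈ Algebra.adjoin ℚ
      (insert μ {x : K | ∃ v : Word, depth v ≤ d - 1 ∧ x = Φ v}) := by
  open NCS.ParityAux in
  have hcount := wordW_count d s hs
  have hodd' : Odd ((wordW d s).count 0) := by
    rwa [← hcount, Nat.add_sub_cancel] at hodd
  set A := Algebra.adjoin ℚ (insert μ {x : K | ∃ v : Word, depth v ≤ d - 1 ∧ x = Φ v}) with hA
  have hμA : μ ∈ A := Algebra.subset_adjoin (Set.mem_insert _ _)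
  have hΦA : Φ ∈ Rm A (d - 1) := fun v hv =>
    Algebra.subset_adjoin (Set.mem_insert_of_mem _ ⟨v, hv, rfl⟩)
  have hΦ1 := hΦ.1.1
  have hΨΦ := inv_mul_S Φ hΦ1
  have hXinv := mul_inv_S (NCS.subst E0 Einf Φ) (subst_nil Φ hΦ1)
  rcases h with ⟨rfl, hD, hH, hS⟩ | ⟨hμ, hD, hH, hS⟩
  · have hD' : NCS.subst E1 E0 Φ = Φ⁻¹ := by
      calc NCS.subst E1 E0 Φ = Φ⁻¹ * Φ * NCS.subst E1 E0 Φ := by rw [hΨΦ, one_mul]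
        _ = Φ⁻¹ := by rw [mul_assoc, hD, mul_one]
    obtain ⟨hXX, hY⟩ := assoc_data Φ hΦ1 hD'
    refine core 0 Φ _ _ _ hΦ hXX hY ?_ ?_ A hμA d hd hΦA _ (wordW_depth d s) (wordW_last d hd s)
      hodd'
    · simp only [zero_div, exp_zero_smul, one_mul, mul_one]
      exact hH
    · have n0 : (E0 : NCS K) [] = 0 := by simp [E0]
      have n1 : (E1 : NCS K) [] = 0 := by simp [E1]
      have ni : (Einf : NCS K) [] = 0 := by simp [Einf, NCS.ParityAux.sub_apply, NCS.ParityAux.neg_apply, n0, n1]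
      simp only [zero_div, neg_zero, exp_zero_smul, one_mul, mul_one, gS_zero_left _ n0,
        gS_zero_left _ n1, gS_zero_left _ ni]
      set X := NCS.subst E0 Einf Φ
      have : -E0 - Φ⁻¹ * E1 * Φ = X⁻¹ * Einf * X := by
        rw [← sub_eq_zero, ← neg_eq_zero, ← hS]; abel
      rw [this, ← mul_assoc, ← mul_assoc, hXinv, one_mul]
  · obtain ⟨hXX, hY⟩ := assoc_data Φ hΦ1 hD
    refine core μ Φ _ _ _ hΦ hXX hY hH ?_ A hμA d hd hΦA _ (wordW_depth d s) (wordW_last d hd s)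
      hodd'
    set X := NCS.subst E0 Einf Φ
    have he'e := exp_mul_neg (-(μ / 2))
    rw [neg_neg] at he'e
    set e := expS ((μ / 2) • (E0 : NCS K))
    set e' := expS ((-(μ / 2)) • (E0 : NCS K))
    set P := -gS (-μ) E0 - Φ⁻¹ * gS (-μ) E1 * Φ * expS ((-μ) • E0) with hP
    have hL : Φ⁻¹ * expS ((-μ) • E1) * Φ * expS ((-μ) • E0) = 1 + μ • P := by
      have neg1 : ∀ f : NCS K, (-μ) • f = -(μ • f) := by
        intro f; funext v; simp [NCS.smul_apply, NCS.ParityAux.neg_apply]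
      have sm : ∀ f g : NCS K, μ • (-f - g) = -(μ • f) - μ • g := by
        intro f g; funext v
        simp only [NCS.smul_apply, NCS.ParityAux.sub_apply, NCS.ParityAux.neg_apply]; ring
      rw [exp_eq_gS (-μ) E1, mul_add, mul_one, add_mul, add_mul, hΨΦ, one_mul, smul_mul_r,
        smul_mul_l, smul_mul_l, hP, sm]
      have hE := exp_eq_gS (-μ) (E0 : NCS K)
      generalize Φ⁻¹ * gS (-μ) E1 * Φ * expS ((-μ) • E0) = T
      rw [hE, neg1, neg1]
      abel
    have hZ : e * X * e' * (1 + μ • P) = (1 + μ • (e * gS μ Einf * e')) * (e * X * e') := by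
      rw [← hL, hS, exp_eq_gS μ Einf]
      have h1 : e * X * e' * (e * X⁻¹ * (1 + μ • gS μ Einf) * X * e') =
          e * (X * (e' * e) * X⁻¹) * (1 + μ • gS μ Einf) * X * e' := by
        simp only [mul_assoc]
      have h2 : (e * gS μ Einf * e') * (e * X * e') = e * gS μ Einf * (e' * e) * X * e' := by
        simp only [mul_assoc]
      rw [h1, he'e, mul_one, hXinv, mul_one, add_mul, one_mul, smul_mul_l, h2, he'e, mul_one,
        mul_add, mul_one, smul_mul_r, add_mul, add_mul, smul_mul_l, smul_mul_l]
    rw [mul_add, add_mul, mul_one, one_mul, smul_mul_r, smul_mul_l] at hZ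
    have h3 := add_left_cancel hZ
    funext v
    have h4 := congrFun h3 v
    simp only [NCS.smul_apply] at h4
    exact mul_left_cancel₀ hμ h4
end
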